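/- arXiv:2308.12935 — 5 statements merged into one kernel-verified Lean document; each statement's English description precedes it below -/
import Mathlib

section
/- Let n ≥ 2, let A ∈ GL(n, ℂ), and let 1 ≤ j ≤ n−1. Then the map z ↦ F_{A·B_j(z)}• is a bijection from ℂ onto the set of complete flags G• that are in position j with respect to F_A•. In particular, the set of flags in position j with respect to a fixed flag is an affine line. -/
noncomputable section

/-- The span of the first `i` columns of the matrix `M`. -/
def colSpan (n : ℕ) (M : Matrix (Fin n) (Fin n) ℂ) (i : ℕ) : Submodule ℂ (Fin n → ℂ) :=
  Submodule.span ℂ ((fun j : Fin n => (fun r => M r j)) '' {j : Fin n | (j : ℕ) < i})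

/-- A complete flag in `ℂⁿ`. -/
def IsFlag (n : ℕ) (F : ℕ → Submodule ℂ (Fin n → ℂ)) : Prop :=
  Monotone F ∧ (∀ i, i ≤ n → Module.finrank ℂ (F i) = i) ∧ ∀ i, n ≤ i → F i = F n

/-- Two flags are in position `j` if they differ precisely in the `j`-th subspace. -/
def InPos (n j : ℕ) (F G : ℕ → Submodule ℂ (Fin n → ℂ)) : Prop :=
  F j ≠ G j ∧ ∀ i, i ≠ j → F i = G i

/-- The matrix `B_j(z)`: the identity except in the (1-indexed) rows and columns
`j, j+1`, where it is the block `[[z, -1], [1, 0]]`. -/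
def Bmat (n : ℕ) (j : ℕ) (z : ℂ) : Matrix (Fin n) (Fin n) ℂ :=
  Matrix.of fun a b =>
    if ((a : ℕ) + 1, (b : ℕ) + 1) = (j, j) then z
    else if ((a : ℕ) + 1, (b : ℕ) + 1) = (j, j + 1) then -1
    else if ((a : ℕ) + 1, (b : ℕ) + 1) = (j + 1, j) then 1
    else if ((a : ℕ) + 1, (b : ℕ) + 1) = (j + 1, j + 1) then 0
    else if a = b then 1 else 0

lemma col_mul_Bmat_of_ne {n : ℕ} (A : Matrix (Fin n) (Fin n) ℂ) {j : ℕ} (z : ℂ) {k : Fin n}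
    (hp : (k : ℕ) + 1 ≠ j) (hq : (k : ℕ) ≠ j) : (A * Bmat n j z).col k = A.col k := by
  have h : ∀ a, Bmat n j z a k = if a = k then 1 else 0 := by
    intro a
    simp [Bmat, hp, hq]
  ext r
  simp [Matrix.mul_apply, h]

lemma col_mul_Bmat_left {n : ℕ} (A : Matrix (Fin n) (Fin n) ℂ) {j : ℕ} (z : ℂ) {p q : Fin n}
    (hp : (p : ℕ) + 1 = j) (hq : (q : ℕ) = j) :
    (A * Bmat n j z).col p = z • A.col p + A.col q := by
  have h : ∀ a, Bmat n j z a p = (if a = p then z else 0) + if a = q then 1 else 0 := by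
    intro a
    simp only [Bmat, Matrix.of_apply, Prod.mk.injEq, Fin.ext_iff]
    split_ifs <;> first | omega | simp
  ext r
  simp [Matrix.mul_apply, h, mul_add, Finset.sum_add_distrib, mul_comm]

lemma col_mul_Bmat_right {n : ℕ} (A : Matrix (Fin n) (Fin n) ℂ) {j : ℕ} (z : ℂ) {p q : Fin n}
    (hp : (p : ℕ) + 1 = j) (hq : (q : ℕ) = j) :
    (A * Bmat n j z).col q = -A.col p := by
  have h : ∀ a, Bmat n j z a q = if a = p then -1 else 0 := by
    intro a
    simp only [Bmat, Matrix.of_apply, Prod.mk.injEq, Fin.ext_iff]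
    split_ifs <;> first | omega | simp
  ext r
  simp [Matrix.mul_apply, h]

lemma colSpan_eq (n : ℕ) (M : Matrix (Fin n) (Fin n) ℂ) (i : ℕ) :
    colSpan n M i = Submodule.span ℂ (M.col '' {k : Fin n | (k : ℕ) < i}) := rfl

lemma col_mem_colSpan {n : ℕ} (M : Matrix (Fin n) (Fin n) ℂ) {i : ℕ} {k : Fin n}
    (hk : (k : ℕ) < i) : M.col k ∈ colSpan n M i :=
  Submodule.subset_span ⟨k, hk, rfl⟩

lemma colSpan_le {n : ℕ} {M : Matrix (Fin n) (Fin n) ℂ} {i : ℕ} {W : Submodule ℂ (Fin n → ℂ)} :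
    colSpan n M i ≤ W ↔ ∀ k : Fin n, (k : ℕ) < i → M.col k ∈ W := by
  simp [colSpan_eq, Submodule.span_le, Set.subset_def]

lemma colSpan_mono (n : ℕ) (M : Matrix (Fin n) (Fin n) ℂ) : Monotone (colSpan n M) :=
  fun _ _ h => colSpan_le.2 fun _ hk => col_mem_colSpan M (hk.trans_le h)

lemma exists_sub_smul_col_mem_colSpan {n : ℕ} {M : Matrix (Fin n) (Fin n) ℂ} {i : ℕ} (k : Fin n)
    (hk : (k : ℕ) = i) {w : Fin n → ℂ} (hw : w ∈ colSpan n M (i + 1)) :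
    ∃ c : ℂ, w - c • M.col k ∈ colSpan n M i := by
  have hs : {l : Fin n | (l : ℕ) < i + 1} = insert k {l : Fin n | (l : ℕ) < i} := by
    ext l
    simp only [Set.mem_ofPred_eq, Set.mem_insert_iff, Fin.ext_iff]
    omega
  rw [colSpan_eq, hs, Set.image_insert_eq, Submodule.mem_span_insert] at hw
  obtain ⟨c, u, hu, rfl⟩ := hw
  exact ⟨c, by simpa [colSpan_eq] using hu⟩

lemma finrank_colSpan {n : ℕ} {M : Matrix (Fin n) (Fin n) ℂ} (hM : LinearIndependent ℂ M.col)
    {i : ℕ} (hi : i ≤ n) : Module.finrank ℂ (colSpan n M i) = i := by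
  have hs : M.col '' {k : Fin n | (k : ℕ) < i} = Set.range (M.col ∘ Fin.castLE hi) := by
    ext v
    constructor
    · rintro ⟨k, hk, rfl⟩
      exact ⟨⟨k, hk⟩, rfl⟩
    · rintro ⟨k, rfl⟩
      exact ⟨Fin.castLE hi k, k.2, rfl⟩
  rw [colSpan_eq, hs, finrank_span_eq_card (hM.comp _ (Fin.castLE_injective hi)), Fintype.card_fin]

lemma isFlag_colSpan {n : ℕ} {M : Matrix (Fin n) (Fin n) ℂ} (hM : LinearIndependent ℂ M.col) :
    IsFlag n (colSpan n M) :=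
  ⟨colSpan_mono n M, fun _ hi => finrank_colSpan hM hi, fun _ hi =>
    le_antisymm (colSpan_le.2 fun k _ => col_mem_colSpan M k.2) (colSpan_mono n M hi)⟩

lemma linearIndependent_col_of_colSpan_eq_top {n : ℕ} {M : Matrix (Fin n) (Fin n) ℂ}
    (hM : colSpan n M n = ⊤) : LinearIndependent ℂ M.col := by
  refine linearIndependent_of_top_le_span_of_card_eq_finrank ?_ (by simp)
  rw [← hM, colSpan_le]
  exact fun k _ => Submodule.subset_span ⟨k, rfl⟩

lemma colSpan_mul_Bmat_of_ne {n : ℕ} (A : Matrix (Fin n) (Fin n) ℂ) {j : ℕ} (z : ℂ) {p q : Fin n}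
    (hp : (p : ℕ) + 1 = j) (hq : (q : ℕ) = j) {i : ℕ} (hi : i ≠ j) :
    colSpan n (A * Bmat n j z) i = colSpan n A i := by
  have hL := col_mul_Bmat_left A z hp hq
  have hR := col_mul_Bmat_right A z hp hq
  apply le_antisymm <;> rw [colSpan_le] <;> intro k hk
  · by_cases hkp : k = p
    · subst hkp
      rw [hL]
      exact add_mem (Submodule.smul_mem _ _ (col_mem_colSpan A (by omega)))
        (col_mem_colSpan A (by omega))
    by_cases hkq : k = q
    · subst hkq
      rw [hR]
      exact neg_mem (col_mem_colSpan A (by omega))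
    rw [col_mul_Bmat_of_ne A z (by omega) (by omega)]
    exact col_mem_colSpan A hk
  · by_cases hkp : k = p
    · subst hkp
      rw [← neg_neg (A.col k), ← hR]
      exact neg_mem (col_mem_colSpan _ (by omega))
    by_cases hkq : k = q
    · subst hkq
      have h : A.col k = (A * Bmat n j z).col p + z • (A * Bmat n j z).col k := by
        rw [hL, hR]
        module
      rw [h]
      exact add_mem (col_mem_colSpan _ (by omega))
        (Submodule.smul_mem _ _ (col_mem_colSpan _ (by omega)))
    rw [← col_mul_Bmat_of_ne A z (k := k) (j := j) (by omega) (by omega)]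
    exact col_mem_colSpan _ hk

lemma linearIndependent_col_mul_Bmat {n : ℕ} {A : Matrix (Fin n) (Fin n) ℂ}
    (hA : LinearIndependent ℂ A.col) {j : ℕ} (z : ℂ) {p q : Fin n}
    (hp : (p : ℕ) + 1 = j) (hq : (q : ℕ) = j) :
    LinearIndependent ℂ (A * Bmat n j z).col := by
  apply linearIndependent_col_of_colSpan_eq_top
  rw [colSpan_mul_Bmat_of_ne A z hp hq (by omega)]
  exact Submodule.eq_top_of_finrank_eq (by simp [finrank_colSpan hA le_rfl])

lemma inPos_colSpan_mul_Bmat {n : ℕ} {A : Matrix (Fin n) (Fin n) ℂ}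
    (hA : LinearIndependent ℂ A.col) {j : ℕ} (z : ℂ) {p q : Fin n}
    (hp : (p : ℕ) + 1 = j) (hq : (q : ℕ) = j) :
    InPos n j (colSpan n A) (colSpan n (A * Bmat n j z)) := by
  refine ⟨fun h => ?_, fun i hi => (colSpan_mul_Bmat_of_ne A z hp hq hi).symm⟩
  have hmem : z • A.col p + A.col q ∈ colSpan n A j := by
    rw [h, ← col_mul_Bmat_left A z hp hq]
    exact col_mem_colSpan _ (by omega)
  rw [Submodule.add_mem_iff_right _
    (Submodule.smul_mem _ _ (col_mem_colSpan A (by omega)))] at hmem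
  exact hA.notMem_span_image (by simp [hq]) hmem

lemma colSpan_mul_Bmat_injective {n : ℕ} {A : Matrix (Fin n) (Fin n) ℂ}
    (hA : LinearIndependent ℂ A.col) {j : ℕ} {p q : Fin n}
    (hp : (p : ℕ) + 1 = j) (hq : (q : ℕ) = j) :
    Function.Injective fun z : ℂ => colSpan n (A * Bmat n j z) := by
  intro z z' h
  by_contra hne
  have hj := congrFun h j
  dsimp only at hj
  have hL := linearIndependent_col_mul_Bmat hA z hp hq
  refine (inPos_colSpan_mul_Bmat hA z hp hq).1 (Submodule.eq_of_le_of_finrank_eq ?_ ?_)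
  · have hz : z • A.col p + A.col q ∈ colSpan n (A * Bmat n j z) j := by
      rw [← col_mul_Bmat_left A z hp hq]
      exact col_mem_colSpan _ (by omega)
    have hz' : z' • A.col p + A.col q ∈ colSpan n (A * Bmat n j z) j := by
      rw [hj, ← col_mul_Bmat_left A z' hp hq]
      exact col_mem_colSpan _ (by omega)
    have hd := sub_mem hz hz'
    rw [add_sub_add_right_eq_sub, ← sub_smul,
      Submodule.smul_mem_iff _ (sub_ne_zero.2 hne)] at hd
    refine colSpan_le.2 fun k hk => ?_
    by_cases hkp : k = p
    · rwa [hkp]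
    · rw [← col_mul_Bmat_of_ne A z (k := k) (j := j) (by omega) (by omega)]
      exact col_mem_colSpan _ hk
  · rw [finrank_colSpan hA (by omega), finrank_colSpan hL (by omega)]

lemma exists_colSpan_mul_Bmat_eq {n : ℕ} {A : Matrix (Fin n) (Fin n) ℂ}
    (hA : LinearIndependent ℂ A.col) {j : ℕ} {p q : Fin n}
    (hp : (p : ℕ) + 1 = j) (hq : (q : ℕ) = j) {G : ℕ → Submodule ℂ (Fin n → ℂ)}
    (hG : IsFlag n G) (hAG : InPos n j (colSpan n A) G) :
    ∃ z : ℂ, colSpan n (A * Bmat n j z) = G := by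
  obtain ⟨hmono, hrank, -⟩ := hG
  obtain ⟨hne, heq⟩ := hAG
  have hjn : j ≤ n := by omega
  obtain ⟨w, hwG, hwA⟩ : ∃ w ∈ G j, w ∉ colSpan n A j := by
    by_contra! hle
    exact hne (Submodule.eq_of_le_of_finrank_eq hle
      (by rw [hrank j hjn, finrank_colSpan hA hjn])).symm
  have hbelow : colSpan n A p ≤ G j := by
    rw [heq p (by omega)]
    exact hmono (by omega)
  have hw : w ∈ colSpan n A (j + 1) := by
    rw [heq (j + 1) (by omega)]
    exact hmono (Nat.le_succ j) hwG
  obtain ⟨b, hb⟩ := exists_sub_smul_col_mem_colSpan q hq hw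
  have hb0 : b ≠ 0 := by
    rintro rfl
    exact hwA (by simpa using hb)
  obtain ⟨a, ha⟩ := exists_sub_smul_col_mem_colSpan p rfl (hp ▸ hb)
  have hmem : (b⁻¹ * a) • A.col p + A.col q ∈ G j := by
    have h := Submodule.smul_mem _ b⁻¹ (sub_mem hwG (hbelow ha))
    convert h using 1
    rw [sub_sub, sub_sub_cancel, smul_add, smul_smul, smul_smul, inv_mul_cancel₀ hb0, one_smul,
      add_comm]
  refine ⟨b⁻¹ * a, funext fun i => ?_⟩
  by_cases hi : i = j
  · subst hi
    refine Submodule.eq_of_le_of_finrank_eq (colSpan_le.2 fun k hk => ?_) ?_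
    · by_cases hkp : k = p
      · rwa [hkp, col_mul_Bmat_left A _ hp hq]
      · rw [col_mul_Bmat_of_ne A _ (by omega) (by omega)]
        exact hbelow (col_mem_colSpan A (by omega))
    · rw [hrank i hjn, finrank_colSpan (linearIndependent_col_mul_Bmat hA _ hp hq) hjn]
  · rw [colSpan_mul_Bmat_of_ne A _ hp hq hi, heq i hi]

/-- For `A ∈ GL(n, ℂ)` and `1 ≤ j ≤ n − 1`, the map `z ↦ F_{A·B_j(z)}•` is a bijection
from `ℂ` onto the set of complete flags in position `j` with respect to `F_A•`. -/
theorem flags_in_position_j_affine_line (n : ℕ) (hn : 2 ≤ n) (A : GL (Fin n) ℂ)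
    (j : ℕ) (hj1 : 1 ≤ j) (hj2 : j ≤ n - 1) :
    Set.BijOn
      (fun z : ℂ => fun i : ℕ => colSpan n ((A : Matrix (Fin n) (Fin n) ℂ) * Bmat n j z) i)
      Set.univ
      {G | IsFlag n G ∧ InPos n j (fun i => colSpan n (A : Matrix (Fin n) (Fin n) ℂ) i) G} := by
  have hA : LinearIndependent ℂ (A : Matrix (Fin n) (Fin n) ℂ).col :=
    Matrix.linearIndependent_cols_of_isUnit A.isUnit
  have hp : ((⟨j - 1, by omega⟩ : Fin n) : ℕ) + 1 = j := Nat.sub_add_cancel hj1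
  have hq : ((⟨j, by omega⟩ : Fin n) : ℕ) = j := rfl
  exact ⟨fun z _ => ⟨isFlag_colSpan (linearIndependent_col_mul_Bmat hA z hp hq),
      inPos_colSpan_mul_Bmat hA z hp hq⟩,
    (colSpan_mul_Bmat_injective hA hp hq).injOn,
    fun _ hG => (exists_colSpan_mul_Bmat_eq hA hp hq hG.1 hG.2).imp fun _ h => ⟨trivial, h⟩⟩
end
end

section
/- Let n ≥ 1 and w ∈ Sₙ. The Schubert cell C_w = {complete flags G• in ℂⁿ : dim(F_std^i ∩ G^j) = #{a ∈ {1,…,i} : w(a) ≤ j} for all i, j ∈ {1,…,n}} is in bijection with ℂ^{ℓ(w)}, where ℓ(w) is the number of inversions of w. That is, C_w is an affine space of dimension ℓ(w). -/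
noncomputable section

/-- The standard flag: `F_std^i = span(e₁, …, e_i)`. -/
def stdFlag (n : ℕ) : ℕ → Submodule ℂ (Fin n → ℂ) := fun i =>
  Submodule.span ℂ
    ((fun b : Fin n => (Pi.single b 1 : Fin n → ℂ)) '' {b : Fin n | (b : ℕ) < i})

/-- Flags `F•, G•` are in relative position `w` if
`dim(Fⁱ ∩ Gʲ) = #(w({1,…,i}) ∩ {1,…,j})` for all `i, j ∈ {1,…,n}`
(the permutation `w` of `{1,…,n}` is encoded as a permutation of `Fin n`,
`0`-indexed). -/
def RelPos (n : ℕ) (w : Equiv.Perm (Fin n)) (F G : ℕ → Submodule ℂ (Fin n → ℂ)) : Prop :=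
  ∀ i j : ℕ, 1 ≤ i → i ≤ n → 1 ≤ j → j ≤ n →
    Module.finrank ℂ ↥(F i ⊓ G j) =
      (Finset.univ.filter fun a : Fin n => (a : ℕ) < i ∧ ((w a : Fin n) : ℕ) < j).card

/-- The number of inversions `ℓ(w)` of a permutation. -/
def invCount (n : ℕ) (w : Equiv.Perm (Fin n)) : ℕ :=
  (Finset.univ.filter fun p : Fin n × Fin n => p.1 < p.2 ∧ w p.2 < w p.1).card

theorem mem_stdFlag {n i : ℕ} {x : Fin n → ℂ} :
    x ∈ stdFlag n i ↔ ∀ b : Fin n, i ≤ b → x b = 0 := by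
  have h := (Pi.basisFun ℂ (Fin n)).mem_span_image (m := x) (s := {b : Fin n | (b : ℕ) < i})
  rw [show (⇑(Pi.basisFun ℂ (Fin n))) = fun b : Fin n => (Pi.single b 1 : Fin n → ℂ) by
    ext b; simp] at h
  refine h.trans ?_
  simp only [Set.subset_def, Finset.mem_coe, Finsupp.mem_support_iff, Pi.basisFun_repr,
    Set.mem_ofPred_eq]
  exact forall_congr' fun b => by rw [← not_lt, not_imp_comm]

/-- The dimensions of the intersections of `V` with the standard flag jump exactly at `S`. -/
def HasPivots {n : ℕ} (V : Submodule ℂ (Fin n → ℂ)) (S : Finset (Fin n)) : Prop :=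
  ∀ i ≤ n, Module.finrank ℂ ↥(stdFlag n i ⊓ V) = (S.filter fun a : Fin n => (a : ℕ) < i).card

theorem stdFlag_mono (n : ℕ) : Monotone (stdFlag n) := fun _ _ hij _ hx =>
  mem_stdFlag.2 fun b hb => mem_stdFlag.1 hx b (hij.trans hb)

theorem HasPivots.eq_zero {n : ℕ} {V : Submodule ℂ (Fin n → ℂ)} {S : Finset (Fin n)}
    (h : HasPivots V S) {x : Fin n → ℂ} (hx : x ∈ V) (hS : ∀ a ∈ S, x a = 0) : x = 0 := by
  suffices H : ∀ i ≤ n, x ∈ stdFlag n i → x = 0 from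
    H n le_rfl (mem_stdFlag.2 fun b hb => absurd b.2 hb.not_gt)
  intro i
  induction i with
  | zero => exact fun _ hx0 => funext fun b => mem_stdFlag.1 hx0 b (Nat.zero_le _)
  | succ i ih =>
    intro hi hxi
    refine ih (by omega) ?_
    by_contra hxi'
    have hlt : stdFlag n i ⊓ V < stdFlag n (i + 1) ⊓ V :=
      lt_of_le_of_ne (inf_le_inf_right _ (stdFlag_mono n i.le_succ)) fun heq =>
        hxi' (heq.ge ⟨hxi, hx⟩).1
    have hcard := Submodule.finrank_lt_finrank_of_lt hlt
    rw [h i (by omega), h (i + 1) hi] at hcard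
    obtain ⟨a, ha, ha'⟩ := Finset.exists_mem_notMem_of_card_lt_card hcard
    simp only [Finset.mem_filter, not_and, not_lt] at ha ha'
    have hai := ha' ha.1
    refine hxi' (mem_stdFlag.2 fun b hb => ?_)
    rcases hb.eq_or_lt with hb | hb
    · rw [show b = a from Fin.ext (by omega)]
      exact hS a ha.1
    · exact mem_stdFlag.1 hxi b hb

theorem HasPivots.exists_reduced {n : ℕ} {V : Submodule ℂ (Fin n → ℂ)} {S : Finset (Fin n)}
    (h : HasPivots V S) {a : Fin n} (ha : a ∈ S) :
    ∃ x ∈ V, x a = 1 ∧ (∀ b ∈ S, b ≠ a → x b = 0) ∧ ∀ b, a < b → x b = 0 := by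
  let T := S.filter fun b : Fin n => (b : ℕ) < a + 1
  let f : ↥(stdFlag n (a + 1) ⊓ V) →ₗ[ℂ] (T → ℂ) :=
    (LinearMap.funLeft ℂ ℂ (Subtype.val : T → Fin n)).comp (Submodule.subtype _)
  have hf : Function.Injective f := by
    rw [injective_iff_map_eq_zero]
    rintro ⟨x, hxF, hxV⟩ hx
    refine Subtype.ext (h.eq_zero hxV fun b hb => ?_)
    by_cases hb' : (b : ℕ) < a + 1
    · exact congrFun hx ⟨b, Finset.mem_filter.2 ⟨hb, hb'⟩⟩
    · exact mem_stdFlag.1 hxF b (not_lt.1 hb')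
  have hdim : Module.finrank ℂ ↥(stdFlag n (a + 1) ⊓ V) = Module.finrank ℂ (T → ℂ) := by
    rw [h (a + 1) a.2, Module.finrank_fintype_fun_eq_card, Fintype.card_coe]
  have haT : a ∈ T := Finset.mem_filter.2 ⟨ha, a.1.lt_succ_self⟩
  obtain ⟨⟨x, hxF, hxV⟩, hx⟩ :=
    (LinearMap.injective_iff_surjective_of_finrank_eq_finrank hdim).1 hf (Pi.single ⟨a, haT⟩ 1)
  have hxT : ∀ b (hb : b ∈ T), x b = (Pi.single ⟨a, haT⟩ 1 : T → ℂ) ⟨b, hb⟩ := fun b hb =>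
    congrFun hx ⟨b, hb⟩
  have hgt : ∀ b, a < b → x b = 0 := fun b hb => mem_stdFlag.1 hxF b hb
  refine ⟨x, hxV, by simp [hxT a haT], fun b hb hba => ?_, hgt⟩
  by_cases hb' : (b : ℕ) < a + 1
  · rw [hxT b (Finset.mem_filter.2 ⟨hb, hb'⟩)]
    exact Pi.single_eq_of_ne (fun h => hba (congrArg Subtype.val h)) _
  · exact mem_stdFlag.1 hxF b (not_lt.1 hb')

/-- A family of vectors whose `a`-th member has leading coordinate `1` in position `a`. -/
def IsUnitriangular {n : ℕ} (v : Fin n → Fin n → ℂ) : Prop :=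
  (∀ a, v a a = 1) ∧ ∀ a b, a < b → v a b = 0

theorem IsUnitriangular.linearIndependent {n : ℕ} {v : Fin n → Fin n → ℂ}
    (hv : IsUnitriangular v) : LinearIndependent ℂ v := by
  refine Matrix.linearIndependent_rows_of_det_ne_zero (A := Matrix.of v) ?_
  rw [Matrix.det_of_isLowerTriangular (Matrix.of v) fun a b hab => hv.2 a b hab]
  simp [hv.1]

theorem LinearIndependent.finrank_span_image {n : ℕ} {v : Fin n → Fin n → ℂ}
    (hv : LinearIndependent ℂ v) (S : Finset (Fin n)) :
    Module.finrank ℂ (Submodule.span ℂ (v '' S)) = S.card := by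
  rw [Set.image_eq_range]
  exact (finrank_span_eq_card (hv.comp (Subtype.val : S → Fin n) Subtype.val_injective)).trans
    (Fintype.card_coe S)

theorem LinearIndependent.span_image_inf {n : ℕ} {v : Fin n → Fin n → ℂ}
    (hv : LinearIndependent ℂ v) (S T : Set (Fin n)) :
    Submodule.span ℂ (v '' S) ⊓ Submodule.span ℂ (v '' T) = Submodule.span ℂ (v '' (S ∩ T)) := by
  have hb : ⇑(basisOfLinearIndependentOfCardEqFinrank' v hv (by simp)) = v :=
    coe_basisOfLinearIndependentOfCardEqFinrank' ..
  generalize basisOfLinearIndependentOfCardEqFinrank' v hv (by simp) = B at hb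
  subst hb
  ext x
  simp only [Submodule.mem_inf, B.mem_span_image, Set.subset_inter_iff]

theorem pi_single_isUnitriangular (n : ℕ) :
    IsUnitriangular fun b : Fin n => (Pi.single b 1 : Fin n → ℂ) :=
  ⟨fun a => by simp, fun a b hab => by simp [hab.ne']⟩

theorem IsUnitriangular.span_eq_stdFlag {n : ℕ} {v : Fin n → Fin n → ℂ}
    (hv : IsUnitriangular v) (i : ℕ) :
    Submodule.span ℂ (v '' {b | (b : ℕ) < i}) = stdFlag n i := by
  refine Submodule.eq_of_le_of_finrank_eq (Submodule.span_le.2 ?_) ?_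
  · rintro _ ⟨a, ha, rfl⟩
    exact mem_stdFlag.2 fun b hb =>
      hv.2 a b (Fin.lt_def.2 (Nat.lt_of_lt_of_le ha hb))
  · rw [stdFlag, show {b : Fin n | (b : ℕ) < i} = (Finset.univ.filter fun b : Fin n => (b : ℕ) < i)
      by simp, hv.linearIndependent.finrank_span_image,
      (pi_single_isUnitriangular n).linearIndependent.finrank_span_image]

theorem IsUnitriangular.hasPivots {n : ℕ} {v : Fin n → Fin n → ℂ}
    (hv : IsUnitriangular v) (S : Finset (Fin n)) :
    HasPivots (Submodule.span ℂ (v '' S)) S := by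
  intro i _
  rw [← hv.span_eq_stdFlag, hv.linearIndependent.span_image_inf,
    show {b : Fin n | (b : ℕ) < i} ∩ S = (S.filter fun b : Fin n => (b : ℕ) < i) by
      ext b; simp [and_comm], hv.linearIndependent.finrank_span_image]

/-- The indices `a` with `w a < j`. -/
def lowSet {n : ℕ} (w : Equiv.Perm (Fin n)) (j : ℕ) : Finset (Fin n) :=
  Finset.univ.filter fun a => (w a : ℕ) < j

theorem mem_lowSet {n : ℕ} {w : Equiv.Perm (Fin n)} {j : ℕ} {a : Fin n} :
    a ∈ lowSet w j ↔ (w a : ℕ) < j := by simp [lowSet]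

theorem card_lowSet {n : ℕ} (w : Equiv.Perm (Fin n)) {j : ℕ} (hj : j ≤ n) :
    (lowSet w j).card = j := by
  have h : (lowSet w j).map w.toEmbedding = Finset.univ.filter fun b : Fin n => (b : ℕ) < j := by
    ext b
    simp [lowSet]
  rw [← Finset.card_map, h, Fin.card_filter_val_lt, min_eq_right hj]

/-- The flag spanned by the vectors `v a`, taken in the order prescribed by `w`. -/
def permFlag {n : ℕ} (w : Equiv.Perm (Fin n)) (v : Fin n → Fin n → ℂ) :
    ℕ → Submodule ℂ (Fin n → ℂ) := fun j => Submodule.span ℂ (v '' lowSet w j)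

theorem mem_permFlag {n : ℕ} (w : Equiv.Perm (Fin n)) (v : Fin n → Fin n → ℂ) {a : Fin n} {j : ℕ}
    (h : (w a : ℕ) < j) : v a ∈ permFlag w v j :=
  Submodule.subset_span ⟨a, mem_lowSet.2 h, rfl⟩

theorem relPos_stdFlag_iff {n : ℕ} {w : Equiv.Perm (Fin n)}
    {G : ℕ → Submodule ℂ (Fin n → ℂ)} :
    RelPos n w (stdFlag n) G ↔ ∀ j, 1 ≤ j → j ≤ n → HasPivots (G j) (lowSet w j) := by
  have key : ∀ i j, (lowSet w j).filter (fun a : Fin n => (a : ℕ) < i) =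
      Finset.univ.filter fun a : Fin n => (a : ℕ) < i ∧ ((w a : Fin n) : ℕ) < j := by
    intro i j
    ext a
    simp [lowSet, and_comm]
  constructor
  · intro h j hj hjn i hi
    rcases i.eq_zero_or_pos with rfl | hi0
    · have : stdFlag n 0 = ⊥ := by simp [stdFlag]
      simp [this]
    · rw [h i j hi0 hi hj hjn, key]
  · intro h i j _ hi hj hjn
    rw [h j hj hjn i hi, key]

theorem permFlag_isFlag {n : ℕ} (w : Equiv.Perm (Fin n)) {v : Fin n → Fin n → ℂ}
    (hv : IsUnitriangular v) : IsFlag n (permFlag w v) := by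
  refine ⟨fun i j hij => Submodule.span_mono (Set.image_mono fun a ha =>
    mem_lowSet.2 ((mem_lowSet.1 ha).trans_le hij)), fun i hi => ?_, fun i hi => ?_⟩
  · rw [permFlag, hv.linearIndependent.finrank_span_image, card_lowSet w hi]
  · have : lowSet w i = lowSet w n := by
      ext a
      simp [mem_lowSet, (w a).2.trans_le hi]
    simp only [permFlag, this]

theorem permFlag_relPos {n : ℕ} (w : Equiv.Perm (Fin n)) {v : Fin n → Fin n → ℂ}
    (hv : IsUnitriangular v) : RelPos n w (stdFlag n) (permFlag w v) :=
  relPos_stdFlag_iff.2 fun _ _ _ => hv.hasPivots _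

/-- The inversions of `w`. -/
abbrev Inversion {n : ℕ} (w : Equiv.Perm (Fin n)) : Type :=
  {p : Fin n × Fin n // p.1 < p.2 ∧ w p.2 < w p.1}

/-- The vectors with coordinates `c` at the inversions of `w` and leading coordinates `1`. -/
def cellVec {n : ℕ} (w : Equiv.Perm (Fin n)) (c : Inversion w → ℂ) (a b : Fin n) : ℂ :=
  if h : b < a ∧ w a < w b then c ⟨(b, a), h⟩ else if b = a then 1 else 0

theorem cellVec_isUnitriangular {n : ℕ} (w : Equiv.Perm (Fin n)) (c : Inversion w → ℂ) :
    IsUnitriangular (cellVec w c) :=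
  ⟨fun a => by simp [cellVec], fun a b hab => by simp [cellVec, hab.not_gt, hab.ne']⟩

theorem cellVec_injective {n : ℕ} (w : Equiv.Perm (Fin n)) : Function.Injective (cellVec w) := by
  intro c d h
  ext ⟨⟨b, a⟩, hp⟩
  simpa [cellVec, hp.1, hp.2] using congrFun (congrFun h a) b

theorem permFlag_cellVec_injective {n : ℕ} (w : Equiv.Perm (Fin n)) :
    Function.Injective fun c => permFlag w (cellVec w c) := by
  intro c d h
  refine cellVec_injective w (funext fun a => sub_eq_zero.1 ?_)
  have hlt : (w a : ℕ) < w a + 1 := Nat.lt_succ_self _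
  refine ((cellVec_isUnitriangular w c).hasPivots (lowSet w (w a + 1))).eq_zero
    (Submodule.sub_mem _ (mem_permFlag w _ hlt) ?_) fun b hb => ?_
  · exact (congrFun h _).ge (mem_permFlag w _ hlt)
  · have hb' : ¬ w a < w b := not_lt.2 (Nat.lt_succ_iff.1 (mem_lowSet.1 hb))
    simp [cellVec, hb']

theorem exists_permFlag_cellVec_eq {n : ℕ} {w : Equiv.Perm (Fin n)}
    {G : ℕ → Submodule ℂ (Fin n → ℂ)} (hG : IsFlag n G) (hw : RelPos n w (stdFlag n) G) :
    ∃ c, permFlag w (cellVec w c) = G := by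
  rw [relPos_stdFlag_iff] at hw
  have hex := fun a : Fin n => (hw (w a + 1) (Nat.le_add_left _ _) (w a).2).exists_reduced
    (mem_lowSet.2 (Nat.lt_succ_self _))
  choose x hxG hx1 hxS hx0 using hex
  let c : Inversion w → ℂ := fun p => x p.1.2 p.1.1
  have hc : cellVec w c = x := by
    ext a b
    unfold cellVec
    split_ifs with h hba
    · rfl
    · rw [hba, hx1]
    · rcases lt_or_gt_of_ne hba with hlt | hgt
      · have hle : w b ≤ w a := not_lt.1 fun h' => h ⟨hlt, h'⟩
        exact (hxS a b (mem_lowSet.2 (Nat.lt_succ_of_le hle)) hba).symm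
      · exact (hx0 a b hgt).symm
  have hflag := permFlag_isFlag w (cellVec_isUnitriangular w c)
  have heq : ∀ j ≤ n, permFlag w (cellVec w c) j = G j := by
    intro j hj
    refine Submodule.eq_of_le_of_finrank_eq (Submodule.span_le.2 ?_)
      ((hflag.2.1 j hj).trans (hG.2.1 j hj).symm)
    rintro _ ⟨a, ha, rfl⟩
    rw [hc]
    exact hG.1 (mem_lowSet.1 ha) (hxG a)
  refine ⟨c, funext fun j => ?_⟩
  rcases le_total j n with hj | hj
  · exact heq j hj
  · rw [hflag.2.2 j hj, hG.2.2 j hj, heq n le_rfl]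

/-- The Schubert cell `C_w = {G• : F_std• →^w G•}` is in bijection with `ℂ^{ℓ(w)}`. -/
theorem schubert_cell_affine_space (n : ℕ) (hn : 1 ≤ n) (w : Equiv.Perm (Fin n)) :
    Nonempty
      ({G : ℕ → Submodule ℂ (Fin n → ℂ) // IsFlag n G ∧ RelPos n w (stdFlag n) G} ≃
        (Fin (invCount n w) → ℂ)) := by
  let f : (Inversion w → ℂ) →
      {G : ℕ → Submodule ℂ (Fin n → ℂ) // IsFlag n G ∧ RelPos n w (stdFlag n) G} := fun c =>
    ⟨permFlag w (cellVec w c), permFlag_isFlag w (cellVec_isUnitriangular w c),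
      permFlag_relPos w (cellVec_isUnitriangular w c)⟩
  have hf : Function.Bijective f := by
    refine ⟨fun c d h => permFlag_cellVec_injective w (congrArg Subtype.val h), ?_⟩
    rintro ⟨G, hG, hw⟩
    obtain ⟨c, hc⟩ := exists_permFlag_cellVec_eq hG hw
    exact ⟨c, Subtype.ext hc⟩
  have hcard : Fintype.card (Inversion w) = invCount n w := Fintype.card_subtype _
  exact ⟨(Equiv.ofBijective f hf).symm.trans
    (Equiv.arrowCongr (Fintype.equivFinOfCardEq hcard) (Equiv.refl ℂ))⟩
end
end

section
/- Let n ≥ 1 and w ∈ Sₙ. The opposite Schubert cell C^w = {complete flags G• in ℂⁿ : dim(G^i ∩ F_ant^j) = #((w₀w)({1,…,i}) ∩ {1,…,j}) for all i, j ∈ {1,…,n}} is in bijection with ℂ^{n(n−1)/2 − ℓ(w)}. That is, C^w is an affine space of dimension n(n−1)/2 − ℓ(w). -/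
noncomputable section

/-- The antistandard flag: `F_ant^i = span(e_n, …, e_{n−i+1})`. -/
def antFlag (n : ℕ) : ℕ → Submodule ℂ (Fin n → ℂ) := fun i =>
  Submodule.span ℂ
    ((fun b : Fin n => (Pi.single b 1 : Fin n → ℂ)) '' {b : Fin n | n ≤ (b : ℕ) + i})

/-- The longest permutation `w₀ : i ↦ n + 1 − i` (0-indexed: `a ↦ n − 1 − a`). -/
def w0perm (n : ℕ) : Equiv.Perm (Fin n) := Fin.revPerm

theorem mem_span_image_iff_exists_sum {n : ℕ} (v : Fin n → Fin n → ℂ) (T : Set (Fin n))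
    (y : Fin n → ℂ) :
    y ∈ Submodule.span ℂ (v '' T) ↔
      ∃ c : Fin n → ℂ, (∀ a, a ∉ T → c a = 0) ∧ ∑ a, c a • v a = y := by
  constructor
  · intro hy
    induction hy using Submodule.span_induction with
    | mem x hx =>
      obtain ⟨a, ha, rfl⟩ := hx
      refine ⟨Pi.single a 1, fun b hb => ?_, ?_⟩
      · exact Pi.single_eq_of_ne (fun h : b = a => hb (h.symm ▸ ha)) _
      · rw [Finset.sum_eq_single a] <;> simp +contextual
    | zero => exact ⟨0, by simp, by simp⟩
    | add x y _ _ hx hy =>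
      obtain ⟨c, hc, rfl⟩ := hx
      obtain ⟨d, hd, rfl⟩ := hy
      exact ⟨c + d, fun a ha => by simp [hc a ha, hd a ha],
        by simp [add_smul, Finset.sum_add_distrib]⟩
    | smul r x _ hx =>
      obtain ⟨c, hc, rfl⟩ := hx
      exact ⟨r • c, fun a ha => by simp [hc a ha], by simp [Finset.smul_sum, smul_smul]⟩
  · rintro ⟨c, hc, rfl⟩
    refine Submodule.sum_mem _ fun a _ => ?_
    by_cases ha : a ∈ T
    · exact Submodule.smul_mem _ _ (Submodule.subset_span ⟨a, ha, rfl⟩)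
    · simp [hc a ha]

theorem mem_antFlag_iff {n j : ℕ} (y : Fin n → ℂ) :
    y ∈ antFlag n j ↔ ∀ b : Fin n, (b : ℕ) + j < n → y b = 0 := by
  have key : ∀ c : Fin n → ℂ, ∑ a, c a • (Pi.single a 1 : Fin n → ℂ) = c := fun c => by
    ext b
    simp [Finset.sum_apply, Pi.single_apply]
  unfold antFlag
  rw [mem_span_image_iff_exists_sum]
  simp only [key, Set.mem_ofPred_eq, not_le]
  exact ⟨fun ⟨c, hc, h⟩ => h ▸ hc, fun h => ⟨y, h, rfl⟩⟩

/-- The vectors `v a` are in echelon form with leading positions `w a` and leading entries `1`. -/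
def IsEchelon {n : ℕ} (w : Equiv.Perm (Fin n)) (v : Fin n → Fin n → ℂ) : Prop :=
  (∀ a, v a (w a) = 1) ∧ ∀ a b, b < w a → v a b = 0

/-- The vectors `v a` are in echelon form, and `v a` vanishes at the leading positions of the
earlier vectors. -/
def IsReducedEchelon {n : ℕ} (w : Equiv.Perm (Fin n)) (v : Fin n → Fin n → ℂ) : Prop :=
  IsEchelon w v ∧ ∀ a a', a' < a → v a (w a') = 0

/-- The chain of subspaces spanned by the initial segments of a family of vectors. -/
def spanChain {n : ℕ} (v : Fin n → Fin n → ℂ) (i : ℕ) : Submodule ℂ (Fin n → ℂ) :=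
  Submodule.span ℂ (v '' {a | (a : ℕ) < i})

namespace IsEchelon

variable {n : ℕ} {w : Equiv.Perm (Fin n)} {v : Fin n → Fin n → ℂ}

theorem coeff_eq_zero (hv : IsEchelon w v) {T : Set (Fin n)} {c : Fin n → ℂ}
    (hc : ∀ a, a ∉ T → c a = 0) {m : ℕ}
    (h : ∀ a ∈ T, (w a : ℕ) < m → (∑ a', c a' • v a') (w a) = 0) :
    ∀ a, (w a : ℕ) < m → c a = 0 := by
  have key : ∀ k : ℕ, ∀ a, (w a : ℕ) = k → (w a : ℕ) < m → c a = 0 := by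
    intro k
    induction k using Nat.strong_induction_on with
    | _ k ih =>
      intro a hk ham
      by_cases haT : a ∈ T
      · have h1 := h a haT ham
        rw [Finset.sum_apply, Finset.sum_eq_single a] at h1
        · simpa [hv.1 a] using h1
        · intro b _ hba
          have hne : w b ≠ w a := fun e => hba (w.injective e)
          rcases lt_or_gt_of_ne hne with hlt | hgt
          · have : (w b : ℕ) < w a := hlt
            simp [ih (w b) (by omega) b rfl (by omega)]
          · simp [hv.2 b (w a) hgt]
        · simp
      · exact hc a haT
  exact fun a => key _ a rfl

theorem linearIndependent (hv : IsEchelon w v) : LinearIndependent ℂ v := by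
  rw [Fintype.linearIndependent_iff]
  intro c hc a
  exact hv.coeff_eq_zero (T := Set.univ) (m := n) (by simp) (fun b _ _ => by rw [hc]; rfl) a (w a).2

theorem finrank_span_image (hv : IsEchelon w v) (T : Finset (Fin n)) :
    Module.finrank ℂ (Submodule.span ℂ (v '' (T : Set (Fin n)))) = T.card := by
  classical
  rw [← Finset.coe_image, finrank_span_finset_eq_card,
    Finset.card_image_of_injective _ hv.linearIndependent.injective]
  rw [Finset.coe_image]
  exact hv.linearIndependent.linearIndepOn_id.mono (Set.image_subset_range _ _)

theorem finrank_spanChain (hv : IsEchelon w v) {i : ℕ} (hi : i ≤ n) :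
    Module.finrank ℂ (spanChain v i) = i := by
  have := hv.finrank_span_image (Finset.univ.filter fun a : Fin n => (a : ℕ) < i)
  rw [Fin.card_filter_val_lt, min_eq_right hi] at this
  rwa [Finset.coe_filter_univ] at this

theorem spanChain_inf_antFlag (hv : IsEchelon w v) (i j : ℕ) :
    spanChain v i ⊓ antFlag n j =
      Submodule.span ℂ (v '' {a | (a : ℕ) < i ∧ n ≤ (w a : ℕ) + j}) := by
  ext y
  rw [Submodule.mem_inf, mem_antFlag_iff, spanChain, mem_span_image_iff_exists_sum,
    mem_span_image_iff_exists_sum]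
  constructor
  · rintro ⟨⟨c, hc, rfl⟩, h⟩
    refine ⟨c, fun a ha => ?_, rfl⟩
    by_cases hai : (a : ℕ) < i
    · refine hv.coeff_eq_zero (m := n - j) hc (fun a' _ h' => h _ (by omega)) a ?_
      have : ¬ n ≤ (w a : ℕ) + j := fun h' => ha ⟨hai, h'⟩
      omega
    · exact hc a hai
  · rintro ⟨c, hc, rfl⟩
    refine ⟨⟨c, fun a ha => hc a fun h => ha h.1, rfl⟩, fun b hb => ?_⟩
    rw [Finset.sum_apply]
    refine Finset.sum_eq_zero fun a _ => ?_
    by_cases ha : n ≤ (w a : ℕ) + j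
    · have hlt : b < w a := by
        rw [Fin.lt_def]
        omega
      simp [hv.2 a b hlt]
    · simp [hc a fun h => ha h.2]

theorem isFlag_spanChain (hv : IsEchelon w v) : IsFlag n (spanChain v) := by
  refine ⟨fun i j hij => ?_, fun i hi => hv.finrank_spanChain hi, fun i hi => ?_⟩
  · exact Submodule.span_mono (Set.image_mono fun a (ha : (a : ℕ) < i) => lt_of_lt_of_le ha hij)
  · have : {a : Fin n | (a : ℕ) < i} = {a : Fin n | (a : ℕ) < n} := by
      ext a
      simp [lt_of_lt_of_le a.2 hi]
    rw [spanChain, spanChain, this]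

end IsEchelon

theorem w0perm_mul_val_lt_iff {n : ℕ} (w : Equiv.Perm (Fin n)) (a : Fin n) (j : ℕ) :
    ((w0perm n * w) a : ℕ) < j ↔ n ≤ (w a : ℕ) + j := by
  have := (w a).2
  simp only [w0perm, Equiv.Perm.mul_apply, Fin.revPerm_apply, Fin.val_rev]
  omega

theorem IsEchelon.relPos_spanChain {n : ℕ} {w : Equiv.Perm (Fin n)} {v : Fin n → Fin n → ℂ}
    (hv : IsEchelon w v) : RelPos n (w0perm n * w) (spanChain v) (antFlag n) := by
  intro i j _ _ _ _
  simp only [w0perm_mul_val_lt_iff]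
  rw [hv.spanChain_inf_antFlag, ← hv.finrank_span_image, Finset.coe_filter_univ]

theorem IsReducedEchelon.eq_of_spanChain_eq {n : ℕ} {w : Equiv.Perm (Fin n)}
    {v v' : Fin n → Fin n → ℂ} (hv : IsReducedEchelon w v) (hv' : IsReducedEchelon w v')
    (h : spanChain v = spanChain v') : v = v' := by
  funext a
  have h1 : v a ∈ spanChain v (a + 1) := Submodule.subset_span ⟨a, by simp, rfl⟩
  have h2 : v' a ∈ spanChain v (a + 1) := h ▸ Submodule.subset_span ⟨a, by simp, rfl⟩
  have hd := Submodule.sub_mem _ h1 h2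
  rw [spanChain, mem_span_image_iff_exists_sum] at hd
  obtain ⟨c, hc, hd⟩ := hd
  have hc0 : ∀ b, c b = 0 := fun b =>
    hv.1.coeff_eq_zero (m := n) hc (fun a' ha' _ => by
      rw [hd, Pi.sub_apply]
      rcases eq_or_lt_of_le (show a' ≤ a from Nat.lt_succ_iff.mp ha') with rfl | hlt
      · rw [hv.1.1, hv'.1.1, sub_self]
      · rw [hv.2 _ _ hlt, hv'.2 _ _ hlt, sub_self]) b (w b).2
  rw [← sub_eq_zero, ← hd]
  simp [hc0]

/-- In the span of a subfamily of an echelon family there is a vector with prescribed entries at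
the leading positions of that subfamily. -/
theorem IsEchelon.exists_mem_span_eq {n : ℕ} {w : Equiv.Perm (Fin n)} {u : Fin n → Fin n → ℂ}
    (hu : IsEchelon w u) (T : Set (Fin n)) (y : Fin n → ℂ) :
    ∃ z ∈ Submodule.span ℂ (u '' T), ∀ a ∈ T, z (w a) = y (w a) := by
  classical
  let e : (T → ℂ) →ₗ[ℂ] (T → ℂ) :=
    { toFun := fun c a => ∑ a', (if h : a' ∈ T then c ⟨a', h⟩ else 0) * u a' (w a)
      map_add' := fun c d => by
        ext a
        simp only [Pi.add_apply, ← Finset.sum_add_distrib]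
        refine Finset.sum_congr rfl fun a' _ => ?_
        split_ifs <;> simp [add_mul]
      map_smul' := fun r c => by
        ext a
        simp only [Pi.smul_apply, smul_eq_mul, RingHom.id_apply, Finset.mul_sum]
        refine Finset.sum_congr rfl fun a' _ => ?_
        split_ifs <;> simp [mul_assoc] }
  have hinj : Function.Injective e := by
    rw [← LinearMap.ker_eq_bot, LinearMap.ker_eq_bot']
    intro c hc
    ext ⟨a, ha⟩
    have := hu.coeff_eq_zero (T := T) (c := fun a' => if h : a' ∈ T then c ⟨a', h⟩ else 0) (m := n)
      (fun a ha => by simp [ha])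
      (fun a ha _ => (Finset.sum_apply _ _ _).trans (congrFun hc ⟨a, ha⟩)) a (w a).2
    simpa [ha] using this
  obtain ⟨c, hc⟩ := LinearMap.injective_iff_surjective.mp hinj fun a => y (w a)
  refine ⟨∑ a', (if h : a' ∈ T then c ⟨a', h⟩ else 0) • u a', ?_, fun a ha => ?_⟩
  · exact (mem_span_image_iff_exists_sum u T _).mpr ⟨_, fun a ha => by simp [ha], rfl⟩
  · exact (Finset.sum_apply _ _ _).trans (congrFun hc ⟨a, ha⟩)

/-- A flag in the cell contains an echelon family adapted to it. -/
theorem exists_isEchelon {n : ℕ} {w : Equiv.Perm (Fin n)} {G : ℕ → Submodule ℂ (Fin n → ℂ)}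
    (hr : RelPos n (w0perm n * w) G (antFlag n)) :
    ∃ u : Fin n → Fin n → ℂ, IsEchelon w u ∧ ∀ a : Fin n, u a ∈ G (a + 1) := by
  have hdim : ∀ i j : ℕ, 1 ≤ i → i ≤ n → j ≤ n → Module.finrank ℂ ↥(G i ⊓ antFlag n j) =
      (Finset.univ.filter fun a : Fin n => (a : ℕ) < i ∧ n ≤ (w a : ℕ) + j).card := by
    intro i j hi hin hj
    rcases Nat.eq_zero_or_pos j with rfl | hj0
    · have : antFlag n 0 = ⊥ := by
        rw [Submodule.eq_bot_iff]
        intro y hy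
        ext b
        exact (mem_antFlag_iff y).mp hy b b.2
      rw [this, inf_bot_eq, finrank_bot, eq_comm, Finset.card_eq_zero,
        Finset.filter_eq_empty_iff]
      intro a _ h
      have := (w a).2
      omega
    · simp only [hr i j hi hin hj0 hj, w0perm_mul_val_lt_iff]
  have hex : ∀ a : Fin n, ∃ x : Fin n → ℂ,
      (x (w a) = 1 ∧ ∀ b, b < w a → x b = 0) ∧ x ∈ G (a + 1) := by
    intro a
    have hwa := (w a).2
    have hlt : Module.finrank ℂ ↥(G (a + 1) ⊓ antFlag n (n - w a - 1)) <
        Module.finrank ℂ ↥(G (a + 1) ⊓ antFlag n (n - w a)) := by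
      rw [hdim _ _ (by omega) (by omega) (by omega), hdim _ _ (by omega) (by omega) (by omega)]
      refine Finset.card_lt_card ?_
      rw [Finset.ssubset_iff_of_subset]
      · refine ⟨a, ?_, ?_⟩
        · simp only [Finset.mem_filter, Finset.mem_univ, true_and]
          omega
        · simp only [Finset.mem_filter, Finset.mem_univ, true_and]
          omega
      · intro b
        simp only [Finset.mem_filter, Finset.mem_univ, true_and]
        omega
    have hnle : ¬ G (a + 1) ⊓ antFlag n (n - w a) ≤ G (a + 1) ⊓ antFlag n (n - w a - 1) :=
      fun h => absurd (Submodule.finrank_mono h) (not_le.mpr hlt)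
    obtain ⟨x, hx, hx'⟩ := SetLike.not_le_iff_exists.mp hnle
    obtain ⟨hxG, hxF⟩ := Submodule.mem_inf.mp hx
    rw [mem_antFlag_iff] at hxF
    have hx0 : ∀ b, b < w a → x b = 0 := fun b hb => hxF b (by
      rw [Fin.lt_def] at hb
      omega)
    have hne : x (w a) ≠ 0 := by
      intro h0
      refine hx' (Submodule.mem_inf.mpr ⟨hxG, (mem_antFlag_iff x).mpr fun b hb => ?_⟩)
      rcases lt_or_eq_of_le (show b ≤ w a by rw [Fin.le_def]; omega) with h | rfl
      · exact hx0 b h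
      · exact h0
    exact ⟨(x (w a))⁻¹ • x, ⟨by simp [hne], fun b hb => by simp [hx0 b hb]⟩,
      Submodule.smul_mem _ _ hxG⟩
  choose u hu hm using hex
  exact ⟨u, ⟨fun a => (hu a).1, fun a => (hu a).2⟩, hm⟩

theorem IsEchelon.exists_isReducedEchelon {n : ℕ} {w : Equiv.Perm (Fin n)}
    {G : ℕ → Submodule ℂ (Fin n → ℂ)} (hG : Monotone G) {u : Fin n → Fin n → ℂ}
    (hu : IsEchelon w u) (hm : ∀ a : Fin n, u a ∈ G (a + 1)) :
    ∃ v : Fin n → Fin n → ℂ, IsReducedEchelon w v ∧ ∀ a : Fin n, v a ∈ G (a + 1) := by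
  choose z hz hzw using fun a => hu.exists_mem_span_eq {a' | a' < a ∧ w a < w a'} (u a)
  have hz0 : ∀ a b, b ≤ w a → z a b = 0 := by
    intro a b hb
    obtain ⟨c, hc, h⟩ := (mem_span_image_iff_exists_sum _ _ _).mp (hz a)
    rw [← h, Finset.sum_apply]
    refine Finset.sum_eq_zero fun a' _ => ?_
    by_cases ha' : w a < w a'
    · simp [hu.2 a' b (lt_of_le_of_lt hb ha')]
    · simp [hc a' fun h => ha' h.2]
  refine ⟨fun a => u a - z a, ⟨⟨fun a => ?_, fun a b hb => ?_⟩, fun a a' ha => ?_⟩, fun a => ?_⟩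
  · simp [hu.1 a, hz0 a _ le_rfl]
  · simp [hu.2 a b hb, hz0 a b hb.le]
  · have hne : w a' ≠ w a := fun e => ha.ne (w.injective e)
    rcases lt_or_gt_of_ne hne with h | h
    · simp [hu.2 a _ h, hz0 a _ h.le]
    · simp [hzw a a' ⟨ha, h⟩]
  · refine Submodule.sub_mem _ (hm a) ?_
    refine (Submodule.span_le.mpr ?_ : Submodule.span ℂ _ ≤ G (a + 1)) (hz a)
    rintro _ ⟨a', ha', rfl⟩
    exact hG (by have : (a' : ℕ) < a := ha'.1; omega) (hm a')

theorem exists_isReducedEchelon_spanChain_eq {n : ℕ} {w : Equiv.Perm (Fin n)}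
    {G : ℕ → Submodule ℂ (Fin n → ℂ)} (hG : IsFlag n G)
    (hr : RelPos n (w0perm n * w) G (antFlag n)) :
    ∃ v : Fin n → Fin n → ℂ, IsReducedEchelon w v ∧ spanChain v = G := by
  obtain ⟨u, hu, hum⟩ := exists_isEchelon hr
  obtain ⟨v, hv, hvm⟩ := hu.exists_isReducedEchelon hG.1 hum
  refine ⟨v, hv, ?_⟩
  have hle : ∀ i ≤ n, spanChain v i = G i := by
    intro i hi
    refine Submodule.eq_of_le_of_finrank_eq (Submodule.span_le.mpr ?_) ?_
    · rintro _ ⟨a, ha, rfl⟩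
      exact hG.1 (Nat.succ_le_of_lt ha) (hvm a)
    · rw [hv.1.finrank_spanChain hi, hG.2.1 i hi]
  funext i
  rcases le_total i n with hi | hi
  · exact hle i hi
  · rw [hv.1.isFlag_spanChain.2.2 i hi, hG.2.2 i hi, hle n le_rfl]

/-- Reduced echelon families are parametrized by their entries at the non-inversions of `w`. -/
def reducedEchelonEquiv {n : ℕ} (w : Equiv.Perm (Fin n)) :
    {v : Fin n → Fin n → ℂ // IsReducedEchelon w v} ≃
      ({p : Fin n × Fin n // p.1 < p.2 ∧ w p.1 < w p.2} → ℂ) where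
  toFun v p := v.1 p.1.1 (w p.1.2)
  invFun x := ⟨fun a b => if b = w a then 1 else
      if h : a < w.symm b ∧ w a < w (w.symm b) then x ⟨(a, w.symm b), h⟩ else 0, by
    refine ⟨⟨fun a => by simp, fun a b hb => ?_⟩, fun a a' ha => ?_⟩
    · simp [hb.ne, hb.not_gt]
    · simp [ha.ne, ha.not_gt]⟩
  left_inv := by
    rintro ⟨v, hv⟩
    ext a b
    obtain ⟨b, rfl⟩ := w.surjective b
    simp only [Equiv.symm_apply_apply, EmbeddingLike.apply_eq_iff_eq]
    split_ifs with h1 h2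
    · rw [h1, hv.1.1]
    · rfl
    · rw [not_and_or, not_lt, not_lt] at h2
      rcases h2 with h2 | h2
      · exact (hv.2 a b (lt_of_le_of_ne h2 h1)).symm
      · exact (hv.1.2 a _ (lt_of_le_of_ne h2 fun e => h1 (w.injective e))).symm
  right_inv := by
    intro x
    ext ⟨⟨a, b⟩, h⟩
    have h' : a < b ∧ w a < w b := h
    simp [h'.1.ne', h'.1, h'.2]

theorem card_filter_fst_lt_snd (n : ℕ) :
    (Finset.univ.filter fun p : Fin n × Fin n => p.1 < p.2).card = n * (n - 1) / 2 := by
  rw [Finset.card_filter, Fintype.sum_prod_type_right]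
  simp only [← Finset.card_filter]
  rw [← Finset.sum_range_id, ← Fin.sum_univ_eq_sum_range (fun i => i)]
  refine Finset.sum_congr rfl fun b _ => ?_
  rw [Finset.filter_gt_eq_Iio, Fin.card_Iio]

theorem card_noninversions {n : ℕ} (w : Equiv.Perm (Fin n)) :
    Fintype.card {p : Fin n × Fin n // p.1 < p.2 ∧ w p.1 < w p.2} =
      n * (n - 1) / 2 - invCount n w := by
  have h := Finset.card_filter_add_card_filter_not
    (s := Finset.univ.filter fun p : Fin n × Fin n => p.1 < p.2) (fun p => w p.1 < w p.2)
  rw [Finset.filter_filter, Finset.filter_filter, card_filter_fst_lt_snd] at h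
  rw [Fintype.card_subtype, ← h, invCount]
  have : (Finset.univ.filter fun p : Fin n × Fin n => p.1 < p.2 ∧ ¬ w p.1 < w p.2) =
      Finset.univ.filter fun p : Fin n × Fin n => p.1 < p.2 ∧ w p.2 < w p.1 := by
    refine Finset.filter_congr fun p _ => and_congr_right fun hp => ?_
    rw [not_lt]
    exact (Ne.le_iff_lt fun e => hp.ne' (w.injective e))
  rw [this, Nat.add_sub_cancel]

/-- The opposite Schubert cell `C^w = {G• : G• →^{w₀w} F_ant•}` is in bijection with
`ℂ^{n(n−1)/2 − ℓ(w)}`. -/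
theorem opposite_schubert_cell_affine_space (n : ℕ) (hn : 1 ≤ n) (w : Equiv.Perm (Fin n)) :
    Nonempty
      ({G : ℕ → Submodule ℂ (Fin n → ℂ) //
          IsFlag n G ∧ RelPos n (w0perm n * w) G (antFlag n)} ≃
        (Fin (n * (n - 1) / 2 - invCount n w) → ℂ)) := by
  let f : {v : Fin n → Fin n → ℂ // IsReducedEchelon w v} →
      {G : ℕ → Submodule ℂ (Fin n → ℂ) //
        IsFlag n G ∧ RelPos n (w0perm n * w) G (antFlag n)} := fun v =>
    ⟨spanChain v.1, v.2.1.isFlag_spanChain, v.2.1.relPos_spanChain⟩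
  have hf : Function.Bijective f := by
    refine ⟨fun v v' h => Subtype.ext ?_, fun ⟨G, hG, hr⟩ => ?_⟩
    · exact v.2.eq_of_spanChain_eq v'.2 (congrArg Subtype.val h)
    · obtain ⟨v, hv, h⟩ := exists_isReducedEchelon_spanChain_eq hG hr
      exact ⟨⟨v, hv⟩, Subtype.ext h⟩
  exact ⟨(Equiv.ofBijective f hf).symm.trans ((reducedEchelonEquiv w).trans
    (Equiv.arrowCongr (Fintype.equivFinOfCardEq (card_noninversions w)) (Equiv.refl ℂ)))⟩
end
end

section
/- Let 1 ≤ k < n and let w ∈ Sₙ be k-Grassmannian, i.e. w⁻¹(1) < ⋯ < w⁻¹(k) and w⁻¹(k+1) < ⋯ < w⁻¹(n). Then the map sending a complete flag G• to its k-th subspace G^k is injective on the Schubert cell C_w = {G• : F_std• →^w G•}; in other words, the restriction to C_w of the natural projection from complete flags to k-dimensional subspaces of ℂⁿ is injective. -/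
noncomputable section

theorem card_filter_fin_val_lt {n j : ℕ} (hj : j ≤ n) :
    (Finset.univ.filter fun b : Fin n => (b : ℕ) < j).card = j := by
  rw [Fin.card_filter_val_lt, min_eq_right hj]

theorem IsFlag.eq_top {n : ℕ} {G : ℕ → Submodule ℂ (Fin n → ℂ)} (hG : IsFlag n G) :
    G n = ⊤ :=
  Submodule.eq_top_of_finrank_eq (by simpa using hG.2.1 n le_rfl)

theorem RelPos.finrank_inf {n : ℕ} {w : Equiv.Perm (Fin n)}
    {F G : ℕ → Submodule ℂ (Fin n → ℂ)} (h : RelPos n w F G)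
    {i j : ℕ} (hi1 : 1 ≤ i) (hin : i ≤ n) (hj1 : 1 ≤ j) (hjn : j ≤ n) :
    Module.finrank ℂ ↥(F i ⊓ G j) =
      (Finset.univ.filter fun b : Fin n => ((w⁻¹ b : Fin n) : ℕ) < i ∧ (b : ℕ) < j).card := by
  rw [h i j hi1 hin hj1 hjn]
  exact Finset.card_bij (fun a _ => w a) (by simp) (by simp)
    (fun b hb => ⟨w⁻¹ b, by simpa using hb, by simp⟩)

theorem RelPos.finrank_left {n : ℕ} {w : Equiv.Perm (Fin n)}
    {F G : ℕ → Submodule ℂ (Fin n → ℂ)} (h : RelPos n w F G) (hG : IsFlag n G)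
    {i : ℕ} (hi1 : 1 ≤ i) (hin : i ≤ n) :
    Module.finrank ℂ ↥(F i) = i := by
  have := h i n hi1 hin (hi1.trans hin) le_rfl
  rw [hG.eq_top, inf_top_eq] at this
  simpa only [Fin.is_lt, and_true, card_filter_fin_val_lt hin] using this

/-- Below the `k`-th step, a flag in relative position `w` is cut out of its `k`-th subspace. -/
theorem RelPos.eq_inf_of_lt {n k : ℕ} (hkn : k ≤ n) {w : Equiv.Perm (Fin n)}
    (hgr : ∀ a b : Fin n, a < b → (b : ℕ) < k → w⁻¹ a < w⁻¹ b)
    {F G : ℕ → Submodule ℂ (Fin n → ℂ)} (h : RelPos n w F G) (hG : IsFlag n G)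
    (p : Fin n) (hp : (p : ℕ) < k) :
    G (p + 1) = F ((w⁻¹ p : Fin n) + 1) ⊓ G k := by
  have hi : ((w⁻¹ p : Fin n) : ℕ) + 1 ≤ n := (w⁻¹ p).isLt
  have hpn : (p : ℕ) + 1 ≤ n := p.isLt
  have key : ∀ b : Fin n, (b : ℕ) < k →
      (((w⁻¹ b : Fin n) : ℕ) < (w⁻¹ p : Fin n) + 1 ↔ (b : ℕ) < p + 1) := by
    intro b hb
    rw [Nat.lt_succ_iff, Nat.lt_succ_iff, ← Fin.le_def, ← Fin.le_def]
    constructor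
    · intro hle
      by_contra! hlt
      exact absurd (hgr p b hlt hb) hle.not_gt
    · intro hle
      rcases hle.eq_or_lt with rfl | hlt
      · exact le_rfl
      · exact (hgr b p hlt hp).le
  have hrank : ∀ m, (p : ℕ) + 1 ≤ m → m ≤ k →
      Module.finrank ℂ ↥(F ((w⁻¹ p : Fin n) + 1) ⊓ G m) = p + 1 := by
    intro m hpm hmk
    rw [h.finrank_inf (by omega) hi (by omega) (by omega)]
    refine Eq.trans (congrArg Finset.card ?_) (card_filter_fin_val_lt hpn)
    ext b
    simp only [Finset.mem_filter, Finset.mem_univ, true_and]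
    have := key b
    omega
  have hGp : F ((w⁻¹ p : Fin n) + 1) ⊓ G (p + 1) = G (p + 1) :=
    Submodule.eq_of_le_of_finrank_eq inf_le_right
      ((hrank _ le_rfl hp).trans (hG.2.1 _ hpn).symm)
  exact Submodule.eq_of_le_of_finrank_eq (le_inf (inf_eq_right.mp hGp) (hG.1 hp))
    ((hG.2.1 _ hpn).trans (hrank k hp le_rfl).symm)

/-- Above the `k`-th step, a flag in relative position `w` is spanned over its `k`-th subspace. -/
theorem RelPos.eq_sup_of_le {n k : ℕ} (hk1 : 1 ≤ k) {w : Equiv.Perm (Fin n)}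
    (hgr : ∀ a b : Fin n, a < b → k ≤ (a : ℕ) → w⁻¹ a < w⁻¹ b)
    {F G : ℕ → Submodule ℂ (Fin n → ℂ)} (h : RelPos n w F G) (hG : IsFlag n G)
    (p : Fin n) (hp : k ≤ (p : ℕ)) :
    G (p + 1) = F ((w⁻¹ p : Fin n) + 1) ⊔ G k := by
  have hi : ((w⁻¹ p : Fin n) : ℕ) + 1 ≤ n := (w⁻¹ p).isLt
  have hpn : (p : ℕ) + 1 ≤ n := p.isLt
  have hFi := h.finrank_left hG (Nat.le_add_left 1 _) hi
  have key : ∀ b : Fin n, k ≤ (b : ℕ) →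
      (((w⁻¹ b : Fin n) : ℕ) < (w⁻¹ p : Fin n) + 1 ↔ (b : ℕ) < p + 1) := by
    intro b hb
    rw [Nat.lt_succ_iff, Nat.lt_succ_iff, ← Fin.le_def, ← Fin.le_def]
    constructor
    · intro hle
      by_contra! hlt
      exact absurd (hgr p b hlt hp) hle.not_gt
    · intro hle
      rcases hle.eq_or_lt with rfl | hlt
      · exact le_rfl
      · exact (hgr b p hlt hb).le
  have hcardF : (Finset.univ.filter fun b : Fin n =>
      ((w⁻¹ b : Fin n) : ℕ) < (w⁻¹ p : Fin n) + 1).card = (w⁻¹ p : Fin n) + 1 := by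
    have := h.finrank_inf (Nat.le_add_left 1 _) hi (by omega) le_rfl
    rw [hG.eq_top, inf_top_eq, hFi] at this
    simpa using this.symm
  have hFG : F ((w⁻¹ p : Fin n) + 1) ≤ G (p + 1) := by
    refine inf_eq_left.mp (Submodule.eq_of_le_of_finrank_eq inf_le_left ?_)
    rw [h.finrank_inf (by omega) hi (by omega) hpn, hFi]
    refine Eq.trans (congrArg Finset.card ?_) hcardF
    ext b
    simp only [Finset.mem_filter, Finset.mem_univ, true_and]
    have := key b
    omega
  refine (Submodule.eq_of_le_of_finrank_eq (sup_le hFG (hG.1 (by omega))) ?_).symm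
  have hdim := Submodule.finrank_sup_add_finrank_inf_eq (F ((w⁻¹ p : Fin n) + 1)) (G k)
  rw [h.finrank_inf (by omega) hi hk1 (by omega), hFi, hG.2.1 k (by omega),
    Finset.filter_and] at hdim
  have hcard := Finset.card_union_add_card_inter
    (Finset.univ.filter fun b : Fin n => ((w⁻¹ b : Fin n) : ℕ) < (w⁻¹ p : Fin n) + 1)
    (Finset.univ.filter fun b : Fin n => (b : ℕ) < k)
  rw [hcardF, card_filter_fin_val_lt (by omega : k ≤ n), ← Finset.filter_or] at hcard
  have hunion : (Finset.univ.filter fun b : Fin n =>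
      ((w⁻¹ b : Fin n) : ℕ) < (w⁻¹ p : Fin n) + 1 ∨ (b : ℕ) < k).card = p + 1 := by
    refine Eq.trans (congrArg Finset.card ?_) (card_filter_fin_val_lt hpn)
    ext b
    simp only [Finset.mem_filter, Finset.mem_univ, true_and]
    have := key b
    omega
  rw [hG.2.1 _ hpn]
  omega

/-- If `w` is `k`-Grassmannian (`w⁻¹` is increasing on `{1,…,k}` and on `{k+1,…,n}`,
encoded 0-indexed), then a complete flag in the Schubert cell `C_w` is determined by
its `k`-th subspace: the projection `G• ↦ G^k` to the Grassmannian is injective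
on `C_w`. -/
theorem grassmannian_projection_injective_on_schubert_cell
    (n k : ℕ) (hk1 : 1 ≤ k) (hkn : k < n) (w : Equiv.Perm (Fin n))
    (hgr1 : ∀ a b : Fin n, a < b → (b : ℕ) < k → w⁻¹ a < w⁻¹ b)
    (hgr2 : ∀ a b : Fin n, a < b → k ≤ (a : ℕ) → w⁻¹ a < w⁻¹ b) :
    ∀ G G' : ℕ → Submodule ℂ (Fin n → ℂ),
      IsFlag n G → IsFlag n G' →
      RelPos n w (stdFlag n) G → RelPos n w (stdFlag n) G' →
      G k = G' k → G = G' := by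
  intro G G' hG hG' h h' hk
  have hle : ∀ j, j ≤ n → G j = G' j := by
    rintro (_ | p) hj
    · rw [Submodule.finrank_eq_zero.mp (hG.2.1 0 hj), Submodule.finrank_eq_zero.mp (hG'.2.1 0 hj)]
    · rcases lt_or_ge p k with hp | hp
      · exact (h.eq_inf_of_lt hkn.le hgr1 hG ⟨p, hj⟩ hp).trans
          ((congrArg _ hk).trans (h'.eq_inf_of_lt hkn.le hgr1 hG' ⟨p, hj⟩ hp).symm)
      · exact (h.eq_sup_of_le hk1 hgr2 hG ⟨p, hj⟩ hp).trans
          ((congrArg _ hk).trans (h'.eq_sup_of_le hk1 hgr2 hG' ⟨p, hj⟩ hp).symm)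
  funext j
  rcases le_total j n with hj | hj
  · exact hle j hj
  · rw [hG.2.2 j hj, hG'.2.2 j hj, hle n le_rfl]
end
end

section
/- Let n ≥ 2, let (j₁, …, j_m) be any word in {1, …, n−1}, and let (d₁, …, d_N), N = n(n−1)/2, be the standard word for the half-twist Δₙ = (σ₁⋯σ_{n−1})(σ₁⋯σ_{n−2})⋯(σ₁σ₂)σ₁. Then the set X̃(γΔₙ) = {(z₁,…,z_{m+N}) ∈ ℂ^{m+N} : B_{j₁}(z₁)⋯B_{j_m}(z_m)·B_{d₁}(z_{m+1})⋯B_{d_N}(z_{m+N}) is upper-triangular} is in bijection with X(γ) × ℂ^N, where X(γ) = {(z₁,…,z_m) ∈ ℂ^m : w₀ⁿ·B_{j₁}(z₁)⋯B_{j_m}(z_m) is upper-triangular}. That is, X̃(β) ≅ X(γ) × ℂ^{n(n−1)/2} for β = γΔₙ. -/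
noncomputable section

/-- The antidiagonal permutation matrix `w₀ⁿ`. -/
def w0mat (n : ℕ) : Matrix (Fin n) (Fin n) ℂ :=
  Matrix.of fun a b => if (a : ℕ) + (b : ℕ) + 1 = n then 1 else 0

/-- The ordered product `B_{j₁}(z₁) ⋯ B_{j_ℓ}(z_ℓ)` along a braid word `l`. -/
def braidProd (n : ℕ) (l : List ℕ) (z : Fin l.length → ℂ) : Matrix (Fin n) (Fin n) ℂ :=
  (List.ofFn fun t : Fin l.length => Bmat n (l.get t) (z t)).prod

/-- The standard word `(1, …, n−1, 1, …, n−2, …, 1, 2, 1)` for the half twist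
`Δₙ = (σ₁⋯σ_{n−1})(σ₁⋯σ_{n−2})⋯(σ₁σ₂)σ₁`. -/
def halfTwistWord (n : ℕ) : List ℕ :=
  ((List.range (n - 1)).reverse).flatMap fun k => (List.range (k + 1)).map (· + 1)

theorem Bmat_apply {n j : ℕ} {a b : Fin n} (ha : (a : ℕ) + 1 = j)
    (hb : (b : ℕ) = j) (z : ℂ) (i k : Fin n) :
    Bmat n j z i k =
      if k = a then (if i = a then z else 0) + (if i = b then 1 else 0)
      else if k = b then (if i = a then -1 else 0) else if i = k then 1 else 0 := by
  simp only [Bmat, Matrix.of_apply, Prod.mk.injEq, Fin.ext_iff]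
  split_ifs <;> first | omega | simp

theorem mul_Bmat_apply {n j : ℕ} {a b : Fin n} (ha : (a : ℕ) + 1 = j)
    (hb : (b : ℕ) = j)
    (M : Matrix (Fin n) (Fin n) ℂ) (z : ℂ) (i k : Fin n) :
    (M * Bmat n j z) i k =
      if k = a then z * M i a + M i b else if k = b then -M i a else M i k := by
  simp only [Matrix.mul_apply, Bmat_apply ha hb]
  split_ifs <;> simp [mul_add, Finset.sum_add_distrib, mul_comm]

theorem Bmat_mul_apply {n j : ℕ} {a b : Fin n} (ha : (a : ℕ) + 1 = j)
    (hb : (b : ℕ) = j)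
    (M : Matrix (Fin n) (Fin n) ℂ) (z : ℂ) (i k : Fin n) :
    (Bmat n j z * M) i k =
      if i = a then z * M a k - M b k else if i = b then M a k else M i k := by
  have hab : a ≠ b := by rintro rfl; omega
  have key : ∀ c, Bmat n j z i c =
      if i = a then (if c = a then z else 0) - (if c = b then 1 else 0)
      else if i = b then (if c = a then 1 else 0) else if c = i then 1 else 0 := by
    intro c
    rw [Bmat_apply ha hb]
    grind
  simp only [Matrix.mul_apply, key]
  split_ifs <;> simp [sub_mul, Finset.sum_sub_distrib]

theorem isUnit_Bmat {n j : ℕ} {a b : Fin n} (ha : (a : ℕ) + 1 = j)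
    (hb : (b : ℕ) = j) (z : ℂ) : IsUnit (Bmat n j z) := by
  have hab : a ≠ b := by rintro rfl; omega
  refine IsUnit.of_mul_eq_one (Matrix.of fun i k =>
    if k = a then -(1 : Matrix (Fin n) (Fin n) ℂ) i b
    else if k = b then (1 : Matrix (Fin n) (Fin n) ℂ) i a + z * (1 : Matrix (Fin n) (Fin n) ℂ) i b
    else (1 : Matrix (Fin n) (Fin n) ℂ) i k) ?_
  ext i k
  rw [Bmat_mul_apply ha hb]
  simp only [Matrix.of_apply, Matrix.one_apply]
  grind

/-- An invertible upper-triangular matrix slides through a braid matrix from left to right,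
changing its parameter by an affine bijection. -/
theorem exists_equiv_mul_Bmat {n j : ℕ} {a b : Fin n} (ha : (a : ℕ) + 1 = j)
    (hb : (b : ℕ) = j)
    {U : Matrix (Fin n) (Fin n) ℂ} (hU : U.BlockTriangular id)
    (hU' : IsUnit U) :
    ∃ e : ℂ ≃ ℂ, ∀ z, ∃ V : Matrix (Fin n) (Fin n) ℂ, V.BlockTriangular id ∧ IsUnit V ∧
      U * Bmat n j z = Bmat n j (e z) * V := by
  have hab : a ≠ b := by rintro rfl; omega
  have hdiag : ∀ i, U i i ≠ 0 := by
    rw [Matrix.isUnit_iff_isUnit_det, Matrix.det_of_isUpperTriangular hU, isUnit_iff_ne_zero,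
      Finset.prod_ne_zero_iff] at hU'
    exact fun i => hU' i (Finset.mem_univ i)
  have haa := hdiag a
  have hbb := hdiag b
  refine ⟨⟨fun z => (z * U a a + U a b) / U b b, fun w => (w * U b b - U a b) / U a a,
    fun z => by field_simp; ring, fun w => by field_simp; ring⟩, fun z => ?_⟩
  simp only [Equiv.coe_fn_mk]
  set z' := (z * U a a + U a b) / U b b with hz'
  have hz : z' * U b b = z * U a a + U a b := by rw [hz']; field_simp
  set Y := U * Bmat n j z with hY
  have hYe := mul_Bmat_apply ha hb U z
  have hmul : Y = Bmat n j z' * Matrix.of fun i k =>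
      if i = a then Y b k else if i = b then -Y a k + z' * Y b k else Y i k := by
    ext i k
    rw [Bmat_mul_apply ha hb]
    simp only [Matrix.of_apply]
    grind
  refine ⟨_, ?_, ?_, hmul⟩
  · intro i k hik
    simp only [id, Fin.lt_def] at hik
    have hU0 : ∀ i k : Fin n, (k : ℕ) < i → U i k = 0 := fun i k h => hU h
    simp only [Matrix.of_apply, hY, hYe]
    by_cases hia : i = a
    · subst hia
      have h1 : k ≠ i := by rintro rfl; omega
      have h2 : k ≠ b := by rintro rfl; omega
      simp only [if_true, h1, h2, if_false]
      exact hU0 _ _ (by omega)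
    by_cases hib : i = b
    · subst hib
      by_cases hka : k = a
      · subst hka
        simp only [hia, if_true, if_false]
        rw [hU0 i k hik]
        linear_combination hz
      · have h2 : k ≠ i := by rintro rfl; omega
        have h3 : (k : ℕ) ≠ a := fun h => hka (Fin.ext h)
        simp only [hia, hka, h2, if_true, if_false]
        rw [hU0 i k hik, hU0 a k (by omega)]
        ring
    have h3 : (i : ℕ) ≠ a := fun h => hia (Fin.ext h)
    have h4 : (i : ℕ) ≠ b := fun h => hib (Fin.ext h)
    simp only [hia, hib, if_false]
    split_ifs with h5 h6
    · subst h5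
      rw [hU0 i k hik, hU0 i b (by omega)]; ring
    · subst h6
      rw [hU0 i a (by omega)]; ring
    · exact hU0 i k hik
  · have h1 : IsUnit Y := hU'.mul (isUnit_Bmat ha hb z)
    rw [hmul] at h1
    rw [Matrix.isUnit_iff_isUnit_det, Matrix.det_mul] at h1
    rw [Matrix.isUnit_iff_isUnit_det]
    exact isUnit_of_mul_isUnit_right h1

theorem exists_fin_indices {n x : ℕ} (hx : 1 ≤ x ∧ x ≤ n - 1) :
    ∃ a b : Fin n, (a : ℕ) + 1 = x ∧ (b : ℕ) = x :=
  ⟨⟨x - 1, by omega⟩, ⟨x, by omega⟩, by simp; omega, rfl⟩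

theorem braidProd_nil (n : ℕ) (z : Fin ([] : List ℕ).length → ℂ) : braidProd n [] z = 1 := by
  simp [braidProd]

theorem braidProd_cons (n x : ℕ) (l : List ℕ) (z : Fin (x :: l).length → ℂ) :
    braidProd n (x :: l) z = Bmat n x (z 0) * braidProd n l (fun i => z i.succ) := by
  simp [braidProd, List.ofFn_succ]

theorem isUnit_braidProd (n : ℕ) (l : List ℕ) (hl : ∀ x ∈ l, 1 ≤ x ∧ x ≤ n - 1)
    (z : Fin l.length → ℂ) : IsUnit (braidProd n l z) := by
  induction l with
  | nil => rw [braidProd_nil]; exact isUnit_one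
  | cons x l ih =>
    obtain ⟨a, b, ha, hb⟩ := exists_fin_indices (hl x (by simp))
    rw [braidProd_cons]
    exact (isUnit_Bmat ha hb _).mul (ih (fun y hy => hl y (by simp [hy])) _)

theorem exists_equiv_braidProd_append (n : ℕ) (l l' : List ℕ) :
    ∃ e : (Fin (l ++ l').length → ℂ) ≃ (Fin l.length → ℂ) × (Fin l'.length → ℂ),
      ∀ z, braidProd n (l ++ l') z = braidProd n l (e z).1 * braidProd n l' (e z).2 := by
  induction l with
  | nil =>
    let : Unique (Fin ([] : List ℕ).length → ℂ) := inferInstanceAs (Unique (Fin 0 → ℂ))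
    exact ⟨(Equiv.uniqueProd _ _).symm, fun z => by rw [braidProd_nil, one_mul]; rfl⟩
  | cons x l ih =>
    obtain ⟨e, he⟩ := ih
    refine ⟨(Fin.consEquiv fun _ : Fin ((l ++ l').length + 1) => ℂ).symm.trans
      (((Equiv.refl ℂ).prodCongr e).trans ((Equiv.prodAssoc _ _ _).symm.trans
        ((Fin.consEquiv fun _ : Fin (l.length + 1) => ℂ).prodCongr (Equiv.refl _)))),
      fun z => ?_⟩
    erw [braidProd_cons n x (l ++ l'), braidProd_cons n x l, he, mul_assoc]
    rfl

theorem exists_equiv_mul_braidProd (n : ℕ) (l : List ℕ) (hl : ∀ x ∈ l, 1 ≤ x ∧ x ≤ n - 1)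
    (U : Matrix (Fin n) (Fin n) ℂ) (hU : U.BlockTriangular id) (hU' : IsUnit U) :
    ∃ e : (Fin l.length → ℂ) ≃ (Fin l.length → ℂ), ∀ z, ∃ V : Matrix (Fin n) (Fin n) ℂ,
      V.BlockTriangular id ∧ IsUnit V ∧ U * braidProd n l z = braidProd n l (e z) * V := by
  induction l generalizing U with
  | nil => exact ⟨Equiv.refl _, fun z => ⟨U, hU, hU', by simp [braidProd_nil]⟩⟩
  | cons x l ih =>
    obtain ⟨a, b, ha, hb⟩ := exists_fin_indices (hl x (by simp))
    obtain ⟨e₀, he₀⟩ := exists_equiv_mul_Bmat ha hb hU hU'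
    choose V hV hV' hUV using he₀
    choose e W hW hW' hVW using fun z₀ =>
      ih (fun y hy => hl y (by simp [hy])) (V z₀) (hV z₀) (hV' z₀)
    refine ⟨(Fin.consEquiv fun _ : Fin (l.length + 1) => ℂ).symm.trans
      ((Equiv.prodShear e₀ e).trans (Fin.consEquiv fun _ : Fin (l.length + 1) => ℂ)),
      fun z => ⟨W (z 0) (fun i => z i.succ), hW _ _, hW' _ _, ?_⟩⟩
    rw [braidProd_cons, ← mul_assoc, hUV, mul_assoc, hVW, ← mul_assoc]
    congr 1
    rw [braidProd_cons]
    rfl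

theorem bijOn_braidProd_append {n : ℕ} {l l' : List ℕ} {R S T : Set (Matrix (Fin n) (Fin n) ℂ)}
    (hR : Set.BijOn (braidProd n l) Set.univ R) (hS : Set.BijOn (braidProd n l') Set.univ S)
    (hT : Set.BijOn (fun p => p.1 * p.2) (R ×ˢ S) T) :
    Set.BijOn (braidProd n (l ++ l')) Set.univ T := by
  obtain ⟨e, he⟩ := exists_equiv_braidProd_append n l l'
  have h1 := hT.comp (hR.prodMap hS)
  rw [Set.univ_prod_univ] at h1
  refine (h1.comp (Set.bijOn_univ.2 e.bijective)).congr fun z _ => ?_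
  simp [he]

/-- The matrices obtained from the braid word `(1, …, k)`. -/
def cycleSet (n k : ℕ) : Set (Matrix (Fin n) (Fin n) ℂ) :=
  {X | (∀ i j : Fin n, (i : ℕ) = 0 → k < j → X i j = 0) ∧
    (∀ i j : Fin n, (i : ℕ) = 0 → (j : ℕ) = k → X i j = (-1) ^ k) ∧
    (∀ i j : Fin n, 0 < (i : ℕ) → (i : ℕ) ≤ k → X i j = if (j : ℕ) + 1 = i then 1 else 0) ∧
    ∀ i j : Fin n, k < i → X i j = if i = j then 1 else 0}

/-- The matrices obtained from the half-twist word on the first `k` of `n` strands. -/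
def halfTwistSet (n k : ℕ) : Set (Matrix (Fin n) (Fin n) ℂ) :=
  {A | (∀ i j : Fin n, (i : ℕ) < k → (j : ℕ) < k → k ≤ i + j → A i j = 0) ∧
    (∀ i j : Fin n, (i : ℕ) + j + 1 = k → A i j = (-1) ^ (j : ℕ)) ∧
    ∀ i j : Fin n, k ≤ i ∨ k ≤ j → A i j = if i = j then 1 else 0}

theorem bijOn_braidProd_nil (n : ℕ) : Set.BijOn (braidProd n []) Set.univ {1} := by
  refine ⟨fun z _ => braidProd_nil n z, fun z _ z' _ _ => ?_, ?_⟩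
  · funext i
    exact i.elim0
  · rintro _ rfl
    exact ⟨fun i => i.elim0, trivial, braidProd_nil n _⟩

theorem bijOn_braidProd_singleton {n x : ℕ} (hx : 1 ≤ x ∧ x ≤ n - 1) :
    Set.BijOn (braidProd n [x]) Set.univ (Set.range (Bmat n x)) := by
  obtain ⟨a, b, ha, hb⟩ := exists_fin_indices hx
  have hab : a ≠ b := by rintro rfl; omega
  have h (z) : braidProd n [x] z = Bmat n x (z 0) := by
    rw [braidProd_cons, braidProd_nil, mul_one]
  refine ⟨fun z _ => ⟨_, (h z).symm⟩, fun z _ z' _ hz => ?_, ?_⟩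
  · rw [h, h] at hz
    have := congrFun (congrFun hz a) a
    rw [Bmat_apply ha hb, Bmat_apply ha hb] at this
    funext i
    obtain rfl : i = 0 := Fin.eq_zero i
    simpa [hab] using this
  · rintro _ ⟨z, rfl⟩
    exact ⟨fun _ => z, trivial, h _⟩

theorem cycleSet_zero {n : ℕ} : cycleSet n 0 = {1} := by
  ext X
  simp only [cycleSet, Set.mem_ofPred_eq, Set.mem_singleton_iff]
  constructor
  · rintro ⟨h1, h2, -, h4⟩
    ext i j
    rw [Matrix.one_apply]
    rcases Nat.eq_zero_or_pos i with hi | hi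
    · rcases Nat.eq_zero_or_pos j with hj | hj
      · rw [h2 i j hi hj, if_pos (Fin.ext (hi.trans hj.symm)), pow_zero]
      · rw [h1 i j hi hj, if_neg]
        rintro rfl
        omega
    · exact h4 i j hi
  · rintro rfl
    refine ⟨?_, ?_, ?_, ?_⟩ <;> intro i j <;> simp only [Matrix.one_apply, Fin.ext_iff] <;> intros <;>
      (try split_ifs) <;> first | rfl | omega | simp

theorem bijOn_cycleSet_mul_Bmat {n k : ℕ} (hk : k + 1 < n) :
    Set.BijOn (fun p : Matrix (Fin n) (Fin n) ℂ × Matrix (Fin n) (Fin n) ℂ => p.1 * p.2)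
      (cycleSet n k ×ˢ Set.range (Bmat n (k + 1))) (cycleSet n (k + 1)) := by
  obtain ⟨a, b, ha, hb⟩ := exists_fin_indices (n := n) (x := k + 1) (by omega)
  have hab : a ≠ b := by rintro rfl; omega
  have mul_apply := mul_Bmat_apply ha hb
  let o : Fin n := ⟨0, by omega⟩
  refine ⟨?_, ?_, ?_⟩
  · rintro ⟨X, _⟩ ⟨⟨h1, h2, h3, h4⟩, z, rfl⟩
    dsimp only at h1 h2 h3 h4
    refine ⟨fun i j hi hj => ?_, fun i j hi hj => ?_, fun i j hi hi' => ?_, fun i j hi => ?_⟩ <;>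
      dsimp only <;> rw [mul_apply]
    · rw [if_neg (by rintro rfl; omega), if_neg (by rintro rfl; omega), h1 i j hi (by omega)]
    · obtain rfl : j = b := Fin.ext (by omega)
      rw [if_neg hab.symm, if_pos rfl, h2 i a hi (by omega), pow_succ]
      ring
    · rcases Nat.lt_or_ge k i with h | h
      · rw [h4 i a h, h4 i b h, h4 i j h]
        simp only [Fin.ext_iff]
        split_ifs <;> first | omega | simp
      · rw [h3 i a hi h, h3 i b hi h, h3 i j hi h]
        simp only [Fin.ext_iff]
        split_ifs <;> first | omega | simp
    · rw [h4 i a (by omega), h4 i b (by omega), h4 i j (by omega)]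
      simp only [Fin.ext_iff]
      split_ifs <;> first | omega | simp
  · rintro ⟨X, _⟩ ⟨⟨h1, h2, -, -⟩, z, rfl⟩ ⟨X', _⟩ ⟨⟨h1', h2', -, -⟩, z', rfl⟩ h
    dsimp only at h1 h2 h1' h2' h
    have h0 := congrFun (congrFun h o) a
    rw [mul_apply, mul_apply, if_pos rfl, if_pos rfl, h1 o b rfl (by omega), h1' o b rfl (by omega),
      h2 o a rfl (by omega), h2' o a rfl (by omega)] at h0
    have hz : z = z' := by simpa using h0
    subst hz
    rw [(isUnit_Bmat ha hb z).mul_left_injective h]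
  · rintro Y ⟨h1, h2, h3, h4⟩
    set z := (-1) ^ k * Y o a with hz
    let X : Matrix (Fin n) (Fin n) ℂ := Matrix.of fun i c =>
      if c = a then -Y i b else if c = b then Y i a + z * Y i b else Y i c
    have hX (i c) : X i c = if c = a then -Y i b else if c = b then Y i a + z * Y i b else Y i c :=
      rfl
    have hs : ((-1 : ℂ) ^ k) * (-1) ^ k = 1 := by rw [← mul_pow]; norm_num
    refine ⟨(X, Bmat n (k + 1) z), ⟨⟨fun i j hi hj => ?_, fun i j hi hj => ?_, fun i j hi hi' => ?_,
      fun i j hi => ?_⟩, z, rfl⟩, ?_⟩ <;> dsimp only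
    · obtain rfl : i = o := Fin.ext hi
      rw [hX, if_neg (by rintro rfl; omega)]
      split_ifs with h
      · rw [h2 o b rfl hb, hz, pow_succ]
        linear_combination (-Y o a) * hs
      · rw [h1 o j rfl]
        have : (j : ℕ) ≠ b := fun h' => h (Fin.ext h')
        omega
    · obtain rfl : j = a := Fin.ext (by omega)
      rw [hX, if_pos rfl, h2 i b hi hb, pow_succ]
      ring
    · rw [hX, h3 i a hi (by omega), h3 i b hi (by omega), h3 i j hi (by omega)]
      simp only [Fin.ext_iff]
      split_ifs <;> first | omega | simp
    · rw [hX]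
      rcases Nat.lt_or_ge (k + 1) i with h | h
      · rw [h4 i a h, h4 i b h, h4 i j h]
        simp only [Fin.ext_iff]
        split_ifs <;> first | omega | simp
      · rw [h3 i a (by omega) h, h3 i b (by omega) h, h3 i j (by omega) h]
        simp only [Fin.ext_iff]
        split_ifs <;> first | omega | simp
    · ext i c
      rw [mul_apply, hX, hX, hX]
      grind

theorem bijOn_braidProd_cycle {n k : ℕ} (hk : k < n) :
    Set.BijOn (braidProd n ((List.range k).map (· + 1))) Set.univ (cycleSet n k) := by
  induction k with
  | zero =>
    rw [cycleSet_zero]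
    exact bijOn_braidProd_nil n
  | succ k ih =>
    rw [List.range_succ, List.map_append]
    exact bijOn_braidProd_append (ih (by omega)) (bijOn_braidProd_singleton (x := k + 1) (by omega))
      (bijOn_cycleSet_mul_Bmat hk)

theorem mul_halfTwistSet_apply_of_le {n k : ℕ} {X A : Matrix (Fin n) (Fin n) ℂ}
    (hA : A ∈ halfTwistSet n k)
    (i j : Fin n) (hj : k ≤ j) : (X * A) i j = X i j := by
  rw [Matrix.mul_apply, Finset.sum_congr rfl fun c _ => by rw [hA.2.2 c j (Or.inr hj)]]
  simp

theorem cycleSet_mul_apply_of_le {n k : ℕ} {X : Matrix (Fin n) (Fin n) ℂ} (hX : X ∈ cycleSet n k)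
    (A : Matrix (Fin n) (Fin n) ℂ) (i i' j : Fin n) (hi : (i' : ℕ) + 1 = i) (hik : (i : ℕ) ≤ k) :
    (X * A) i j = A i' j := by
  have h (c : Fin n) : ((c : ℕ) + 1 = i) ↔ c = i' := by rw [Fin.ext_iff]; omega
  rw [Matrix.mul_apply, Finset.sum_congr rfl fun c _ => by rw [hX.2.2.1 i c (by omega) hik]]
  simp [h]

theorem cycleSet_mul_apply_of_lt {n k : ℕ} {X : Matrix (Fin n) (Fin n) ℂ} (hX : X ∈ cycleSet n k)
    (A : Matrix (Fin n) (Fin n) ℂ) (i j : Fin n) (hik : k < i) : (X * A) i j = A i j := by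
  rw [Matrix.mul_apply, Finset.sum_congr rfl fun c _ => by rw [hX.2.2.2 i c hik]]
  simp

theorem bijOn_cycleSet_mul_halfTwistSet {n k : ℕ} (hk : k < n)
    (hunit : ∀ A ∈ halfTwistSet n k, IsUnit A) :
    Set.BijOn (fun p : Matrix (Fin n) (Fin n) ℂ × Matrix (Fin n) (Fin n) ℂ => p.1 * p.2)
      (cycleSet n k ×ˢ halfTwistSet n k) (halfTwistSet n (k + 1)) := by
  refine ⟨?_, ?_, ?_⟩
  · rintro ⟨X, A⟩ ⟨hX, hA⟩
    dsimp only at hX hA ⊢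
    refine ⟨fun i j hi hj hij => ?_, fun i j hij => ?_, fun i j hij => ?_⟩
    · rcases Nat.eq_zero_or_pos i with h0 | h0
      · omega
      let i' : Fin n := ⟨i - 1, by omega⟩
      have hi' : (i' : ℕ) + 1 = i := Nat.sub_add_cancel h0
      rw [cycleSet_mul_apply_of_le hX A i i' j hi' (by omega)]
      rcases Nat.lt_or_ge j k with h | h
      · exact hA.1 i' j (by omega) h (by omega)
      · rw [hA.2.2 i' j (Or.inr h), if_neg]
        rw [Fin.ext_iff]
        omega
    · rcases Nat.eq_zero_or_pos i with h0 | h0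
      · rw [mul_halfTwistSet_apply_of_le hA i j (by omega), hX.2.1 i j h0 (by omega)]
        congr 1
        omega
      let i' : Fin n := ⟨i - 1, by omega⟩
      have hi' : (i' : ℕ) + 1 = i := Nat.sub_add_cancel h0
      rw [cycleSet_mul_apply_of_le hX A i i' j hi' (by omega)]
      exact hA.2.1 i' j (by omega)
    · rcases Nat.lt_or_ge k i with h | h
      · rw [cycleSet_mul_apply_of_lt hX A i j h]
        exact hA.2.2 i j (by omega)
      · have hj : k + 1 ≤ j := by omega
        rw [mul_halfTwistSet_apply_of_le hA i j (by omega), if_neg (by rw [Fin.ext_iff]; omega)]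
        rcases Nat.eq_zero_or_pos i with h0 | h0
        · exact hX.1 i j h0 hj
        · rw [hX.2.2.1 i j h0 h, if_neg (by omega)]
  · rintro ⟨X, A⟩ ⟨hX, hA⟩ ⟨X', A'⟩ ⟨hX', hA'⟩ h
    dsimp only at hX hA hX' hA' h
    obtain rfl : A = A' := by
      ext i j
      rcases Nat.lt_or_ge i k with hi | hi
      · let i' : Fin n := ⟨i + 1, by omega⟩
        rw [← cycleSet_mul_apply_of_le hX A i' i j rfl hi, h,
          cycleSet_mul_apply_of_le hX' A' i' i j rfl hi]
      · rw [hA.2.2 i j (Or.inl hi), hA'.2.2 i j (Or.inl hi)]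
    rw [(hunit A hA).mul_left_injective h]
  · rintro Y ⟨h1, h2, h3⟩
    let A : Matrix (Fin n) (Fin n) ℂ := Matrix.of fun i j =>
      if h : (i : ℕ) < k then Y ⟨i + 1, by omega⟩ j else if i = j then 1 else 0
    have hAlt (i j : Fin n) (h : (i : ℕ) < k) : A i j = Y ⟨i + 1, by omega⟩ j := dif_pos h
    have hAge (i j : Fin n) (h : k ≤ i) : A i j = if i = j then 1 else 0 := dif_neg (by omega)
    have hA : A ∈ halfTwistSet n k := by
      refine ⟨fun i j hi hj hij => ?_, fun i j hij => ?_, fun i j hij => ?_⟩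
      · rw [hAlt i j hi]
        exact h1 _ j (by simp; omega) (by omega) (by simp; omega)
      · rw [hAlt i j (by omega)]
        exact h2 _ j (by simp; omega)
      · rcases Nat.lt_or_ge i k with hi | hi
        · have hj : k ≤ j := by omega
          rw [hAlt i j hi, if_neg (by rw [Fin.ext_iff]; omega)]
          rcases hj.eq_or_lt with hj | hj
          · exact h1 _ j (by simp; omega) (by omega) (by simp; omega)
          · rw [h3 _ j (Or.inr hj), if_neg]
            rw [Fin.ext_iff]
            simp
            omega
        · exact hAge i j hi
    have hdet := (Matrix.isUnit_iff_isUnit_det A).1 (hunit A hA)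
    have hXA : Y * A⁻¹ * A = Y := Matrix.nonsing_inv_mul_cancel_right A Y hdet
    refine ⟨(Y * A⁻¹, A), ⟨?_, hA⟩, hXA⟩
    have hcol (i j : Fin n) (hj : k ≤ j) : (Y * A⁻¹) i j = Y i j := by
      rw [← mul_halfTwistSet_apply_of_le (X := Y * A⁻¹) hA i j hj, hXA]
    have hrow (i i' j : Fin n) (h : ∀ c, Y i c = A i' c) :
        (Y * A⁻¹) i j = if i' = j then 1 else 0 := by
      rw [← Matrix.one_apply, ← Matrix.mul_nonsing_inv A hdet]
      simp only [Matrix.mul_apply, h]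
    refine ⟨fun i j hi hj => ?_, fun i j hi hj => ?_, fun i j hi hi' => ?_, fun i j hi => ?_⟩ <;>
      dsimp only
    · rw [hcol i j hj.le, h3 i j (Or.inr hj), if_neg]
      rw [Fin.ext_iff]
      omega
    · rw [hcol i j hj.ge, h2 i j (by omega), hj]
    · have e : (⟨(⟨i - 1, by omega⟩ : Fin n) + 1, by simp; omega⟩ : Fin n) = i :=
        Fin.ext (Nat.sub_add_cancel hi)
      rw [hrow i ⟨i - 1, by omega⟩ j fun c => by rw [hAlt _ _ (by simp; omega), e]]
      simp only [Fin.ext_iff]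
      congr 1
      simp
      omega
    · exact hrow i i j fun c => by rw [hAge i c hi.le, h3 i c (Or.inl hi)]

theorem halfTwistWord_add_two (k : ℕ) :
    halfTwistWord (k + 2) = (List.range (k + 1)).map (· + 1) ++ halfTwistWord (k + 1) := by
  simp [halfTwistWord, List.range_succ, List.reverse_append]

theorem mem_halfTwistWord {k x : ℕ} (hx : x ∈ halfTwistWord k) : 1 ≤ x ∧ x ≤ k - 1 := by
  simp only [halfTwistWord, List.mem_flatMap, List.mem_reverse, List.mem_range, List.mem_map] at hx
  obtain ⟨c, hc, d, hd, rfl⟩ := hx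
  omega

theorem length_halfTwistWord (k : ℕ) : (halfTwistWord (k + 1)).length = (k + 1) * k / 2 := by
  have h : (halfTwistWord (k + 1)).length * 2 = (k + 1) * k := by
    induction k with
    | zero => simp [halfTwistWord]
    | succ k ih =>
      rw [halfTwistWord_add_two, List.length_append, add_mul, ih]
      simp
      ring
  omega

theorem halfTwistSet_one (n : ℕ) : halfTwistSet n 1 = {1} := by
  ext X
  simp only [halfTwistSet, Set.mem_ofPred_eq, Set.mem_singleton_iff]
  constructor
  · rintro ⟨-, h2, h3⟩
    ext i j
    rw [Matrix.one_apply]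
    by_cases h : 1 ≤ (i : ℕ) ∨ 1 ≤ (j : ℕ)
    · exact h3 i j h
    · rw [h2 i j (by omega), if_pos (Fin.ext (by omega))]
      obtain h : (j : ℕ) = 0 := by omega
      rw [h, pow_zero]
  · rintro rfl
    refine ⟨fun i j hi hj hij => by omega, fun i j hij => ?_, fun i j _ => Matrix.one_apply⟩
    obtain ⟨hi, hj⟩ : (i : ℕ) = 0 ∧ (j : ℕ) = 0 := by omega
    rw [Matrix.one_apply, if_pos (Fin.ext (by omega)), hj, pow_zero]

theorem bijOn_braidProd_halfTwistWord {n k : ℕ} (hk : k < n) :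
    Set.BijOn (braidProd n (halfTwistWord (k + 1))) Set.univ (halfTwistSet n (k + 1)) := by
  induction k with
  | zero =>
    rw [zero_add, halfTwistSet_one]
    exact bijOn_braidProd_nil n
  | succ k ih =>
    rw [halfTwistWord_add_two]
    have h := ih (by omega)
    refine bijOn_braidProd_append (bijOn_braidProd_cycle hk) h
      (bijOn_cycleSet_mul_halfTwistSet hk fun A hA => ?_)
    obtain ⟨z, -, rfl⟩ := h.surjOn hA
    refine isUnit_braidProd n _ (fun x hx => ?_) z
    have := mem_halfTwistWord hx
    omega

theorem Matrix.BlockTriangular.nonsing_inv {n : ℕ} {U : Matrix (Fin n) (Fin n) ℂ}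
    (hU : U.BlockTriangular id) (hU' : IsUnit U) : U⁻¹.BlockTriangular id := by
  have := hU'.invertible
  exact Matrix.blockTriangular_inv_of_blockTriangular hU

theorem mul_w0mat_apply {n : ℕ} (M : Matrix (Fin n) (Fin n) ℂ) (i j : Fin n) :
    (M * w0mat n) i j = M i j.rev := by
  have h (c : Fin n) : (c : ℕ) + j + 1 = n ↔ c = j.rev := by
    rw [Fin.ext_iff, Fin.val_rev]
    omega
  simp [Matrix.mul_apply, w0mat, h]

theorem w0mat_mul_apply {n : ℕ} (M : Matrix (Fin n) (Fin n) ℂ) (i j : Fin n) :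
    (w0mat n * M) i j = M i.rev j := by
  have h (c : Fin n) : (i : ℕ) + c + 1 = n ↔ c = i.rev := by
    rw [Fin.ext_iff, Fin.val_rev]
    omega
  simp [Matrix.mul_apply, w0mat, h]

theorem w0mat_mul_self (n : ℕ) : w0mat n * w0mat n = 1 := by
  ext i j
  rw [mul_w0mat_apply, Matrix.one_apply]
  simp only [w0mat, Matrix.of_apply, Fin.val_rev, Fin.ext_iff]
  congr 1
  simp
  omega

theorem isUnit_w0mat (n : ℕ) : IsUnit (w0mat n) :=
  IsUnit.of_mul_eq_one _ (w0mat_mul_self n)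

theorem blockTriangular_mul_w0mat {n : ℕ} {A : Matrix (Fin n) (Fin n) ℂ}
    (hA : A ∈ halfTwistSet n n) : (A * w0mat n).BlockTriangular id := by
  intro i j hij
  simp only [id, Fin.lt_def] at hij
  rw [mul_w0mat_apply]
  exact hA.1 _ _ i.2 j.rev.2 (by rw [Fin.val_rev]; omega)

theorem exists_mul_diagonal_mem_halfTwistSet {n : ℕ} {A : Matrix (Fin n) (Fin n) ℂ}
    (hA : (A * w0mat n).BlockTriangular id) (hA' : IsUnit A) :
    ∃ d : Fin n → ℂ, IsUnit (Matrix.diagonal d) ∧ A * Matrix.diagonal d ∈ halfTwistSet n n := by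
  have hne (j : Fin n) : A j.rev j ≠ 0 := by
    have h := hA'.mul (isUnit_w0mat n)
    rw [Matrix.isUnit_iff_isUnit_det, Matrix.det_of_isUpperTriangular hA, isUnit_iff_ne_zero,
      Finset.prod_ne_zero_iff] at h
    simpa [mul_w0mat_apply] using h j.rev (Finset.mem_univ _)
  refine ⟨fun j => (A j.rev j)⁻¹ * (-1) ^ (j : ℕ), ?_, fun i j _ _ hij => ?_, fun i j hij => ?_,
    fun i j hij => by omega⟩
  · rw [Matrix.isUnit_diagonal, Pi.isUnit_iff]
    exact fun j => isUnit_iff_ne_zero.2 (mul_ne_zero (inv_ne_zero (hne j)) (by simp))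
  · have h := hA (i := i) (j := j.rev) (by simp only [id, Fin.lt_def, Fin.val_rev]; omega)
    rw [mul_w0mat_apply, Fin.rev_rev] at h
    rw [Matrix.mul_diagonal, h, zero_mul]
  · obtain rfl : i = j.rev := by rw [Fin.ext_iff, Fin.val_rev]; omega
    rw [Matrix.mul_diagonal, mul_inv_cancel_left₀ (hne j)]

theorem eq_of_blockTriangular_inv_mul {n : ℕ} {A A' : Matrix (Fin n) (Fin n) ℂ}
    (hA : A ∈ halfTwistSet n n) (hA' : A' ∈ halfTwistSet n n) (hu : IsUnit A)
    (h : (A⁻¹ * A').BlockTriangular id) : A = A' := by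
  have hdet := (Matrix.isUnit_iff_isUnit_det A).1 hu
  set V := A⁻¹ * A' with hV
  have hAV : A' = A * V := (Matrix.mul_nonsing_inv_cancel_left A A' hdet).symm
  have hJ : (w0mat n)⁻¹ = w0mat n := Matrix.inv_eq_right_inv (w0mat_mul_self n)
  have hlow : (w0mat n * V * w0mat n).BlockTriangular id := by
    have h1 := ((blockTriangular_mul_w0mat hA).nonsing_inv (hu.mul (isUnit_w0mat n))).mul
      (blockTriangular_mul_w0mat hA')
    rwa [Matrix.mul_inv_rev, hJ, mul_assoc, ← mul_assoc A⁻¹, ← hV, ← mul_assoc] at h1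
  have hdiag (i j : Fin n) (hij : i ≠ j) : V i j = 0 := by
    rcases lt_or_gt_of_ne hij with hij | hij
    · have h1 := hlow (i := i.rev) (j := j.rev) (Fin.rev_lt_rev.2 hij)
      rwa [mul_w0mat_apply, w0mat_mul_apply, Fin.rev_rev, Fin.rev_rev] at h1
    · exact h hij
  have hone (j : Fin n) : V j j = 1 := by
    have h1 := congrFun (congrFun hAV j.rev) j
    have hj : (j.rev : ℕ) + j + 1 = n := by rw [Fin.val_rev]; omega
    rw [Matrix.mul_apply, Finset.sum_eq_single j (fun c _ hc => by rw [hdiag c j hc, mul_zero])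
      (by simp), hA.2.1 _ _ hj, hA'.2.1 _ _ hj] at h1
    exact (mul_eq_left₀ (by simp)).1 h1.symm
  have hV1 : V = 1 := by
    ext i j
    rw [Matrix.one_apply]
    split_ifs with hij
    · rw [hij, hone]
    · exact hdiag i j hij
  rw [hAV, hV1, mul_one]

theorem blockTriangular_mul_iff_of_isUnit {n : ℕ} (M : Matrix (Fin n) (Fin n) ℂ)
    {V : Matrix (Fin n) (Fin n) ℂ} (hV : V.BlockTriangular id) (hV' : IsUnit V) :
    (M * V).BlockTriangular id ↔ M.BlockTriangular id := by
  refine ⟨fun h => ?_, fun h => h.mul hV⟩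
  have h1 := h.mul (hV.nonsing_inv hV')
  rwa [Matrix.mul_nonsing_inv_cancel_right _ _ ((Matrix.isUnit_iff_isUnit_det V).1 hV')] at h1

/-- `M ∈ B A⁻¹` for some half-twist matrix `A` iff `M ∈ A B` for some half-twist matrix `A`: both
say that `M` lies in the big Bruhat cell. -/
theorem exists_mem_halfTwistSet_iff {n : ℕ} (hS : ∀ A ∈ halfTwistSet n n, IsUnit A)
    {M : Matrix (Fin n) (Fin n) ℂ} (hM : IsUnit M) :
    (∃ A ∈ halfTwistSet n n, (M * A).BlockTriangular id) ↔
      ∃ A ∈ halfTwistSet n n, (A⁻¹ * M).BlockTriangular id := by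
  have hJ := isUnit_w0mat n
  constructor
  · rintro ⟨A, hA, hb⟩
    have hu := hS A hA
    obtain ⟨d, hd, hmem⟩ := exists_mul_diagonal_mem_halfTwistSet (A := M * A * w0mat n)
      (by rwa [mul_assoc, w0mat_mul_self, mul_one]) ((hM.mul hu).mul hJ)
    refine ⟨_, hmem, ?_⟩
    have h1 : (M * A * w0mat n * Matrix.diagonal d)⁻¹ * M =
        (Matrix.diagonal d)⁻¹ * (A * w0mat n)⁻¹ := by
      rw [mul_assoc M, mul_assoc M, Matrix.mul_inv_rev, Matrix.mul_inv_rev (A * w0mat n),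
        Matrix.nonsing_inv_mul_cancel_right _ _ ((Matrix.isUnit_iff_isUnit_det M).1 hM)]
    rw [h1]
    exact ((Matrix.blockTriangular_diagonal d).nonsing_inv hd).mul
      ((blockTriangular_mul_w0mat hA).nonsing_inv (hu.mul hJ))
  · rintro ⟨A, hA, hb⟩
    have hu := hS A hA
    have hAdet := (Matrix.isUnit_iff_isUnit_det A).1 hu
    have hbu : IsUnit (A⁻¹ * M) := (Matrix.isUnit_nonsing_inv_iff.2 hu).mul hM
    obtain ⟨d, hd, hmem⟩ := exists_mul_diagonal_mem_halfTwistSet (A := (A⁻¹ * M)⁻¹ * w0mat n)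
      (by rw [mul_assoc, w0mat_mul_self, mul_one]; exact hb.nonsing_inv hbu)
      ((Matrix.isUnit_nonsing_inv_iff.2 hbu).mul hJ)
    refine ⟨_, hmem, ?_⟩
    have h1 : M * ((A⁻¹ * M)⁻¹ * w0mat n * Matrix.diagonal d) =
        A * w0mat n * Matrix.diagonal d := by
      rw [Matrix.mul_inv_rev, Matrix.nonsing_inv_nonsing_inv _ hAdet, mul_assoc, mul_assoc,
        Matrix.mul_nonsing_inv_cancel_left _ _ ((Matrix.isUnit_iff_isUnit_det M).1 hM), mul_assoc]
    rw [h1]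
    exact (blockTriangular_mul_w0mat hA).mul (Matrix.blockTriangular_diagonal d)

/-- Two partial functions with the same domain have equivalent graphs. -/
theorem nonempty_equiv_graph {α β : Type*} {P Q : α → β → Prop}
    (hP : ∀ a b b', P a b → P a b' → b = b') (hQ : ∀ a b b', Q a b → Q a b' → b = b')
    (h : ∀ a, (∃ b, P a b) ↔ ∃ b, Q a b) :
    Nonempty ({p : α × β // P p.1 p.2} ≃ {p : α × β // Q p.1 p.2}) := by
  have key {R : α → β → Prop} (hR : ∀ a b b', R a b → R a b' → b = b') :
      Function.Bijective (fun p : {p : α × β // R p.1 p.2} =>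
        (⟨p.1.1, p.1.2, p.2⟩ : {a // ∃ b, R a b})) := by
    refine ⟨?_, fun ⟨a, b, hb⟩ => ⟨⟨(a, b), hb⟩, rfl⟩⟩
    rintro ⟨⟨a, b⟩, hab⟩ ⟨⟨a', b'⟩, hab'⟩ haa
    obtain rfl : a = a' := congrArg Subtype.val haa
    obtain rfl := hR a b b' hab hab'
    rfl
  exact ⟨(Equiv.ofBijective _ (key hP)).trans
    ((Equiv.subtypeEquivRight h).trans (Equiv.ofBijective _ (key hQ)).symm)⟩

/-- For `β = γΔₙ`, the variety `X̃(β)` (both endpoint flags standard) is in bijection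
with `X(γ) × ℂ^{n(n−1)/2}`. -/
theorem Xtilde_of_gamma_Delta (n : ℕ) (hn : 2 ≤ n) (l : List ℕ)
    (hl : ∀ x ∈ l, 1 ≤ x ∧ x ≤ n - 1) :
    Nonempty
      ({z : Fin (l ++ halfTwistWord n).length → ℂ //
          (braidProd n (l ++ halfTwistWord n) z).BlockTriangular id} ≃
        {z : Fin l.length → ℂ // (w0mat n * braidProd n l z).BlockTriangular id} ×
          (Fin (n * (n - 1) / 2) → ℂ)) := by
  obtain ⟨e₀, he₀⟩ := exists_equiv_braidProd_append n l (halfTwistWord n)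
  have hbij : Set.BijOn (braidProd n (halfTwistWord n)) Set.univ (halfTwistSet n n) := by
    obtain ⟨k, rfl⟩ : ∃ k, n = k + 1 := ⟨n - 1, by omega⟩
    exact bijOn_braidProd_halfTwistWord k.lt_succ_self
  have hlen : (halfTwistWord n).length = n * (n - 1) / 2 := by
    obtain ⟨k, rfl⟩ : ∃ k, n = k + 1 := ⟨n - 1, by omega⟩
    exact length_halfTwistWord k
  have hmem (w) : braidProd n (halfTwistWord n) w ∈ halfTwistSet n n := hbij.mapsTo trivial
  have hunit (w) : IsUnit (braidProd n (halfTwistWord n) w) :=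
    isUnit_braidProd n _ (fun x hx => mem_halfTwistWord hx) w
  have hMunit (z) : IsUnit (braidProd n l z) := isUnit_braidProd n l hl z
  have hS : ∀ A ∈ halfTwistSet n n, IsUnit A := fun A hA => by
    obtain ⟨w, -, rfl⟩ := hbij.surjOn hA
    exact hunit w
  have hex (p : Matrix (Fin n) (Fin n) ℂ → Prop) :
      (∃ w, p (braidProd n (halfTwistWord n) w)) ↔ ∃ A ∈ halfTwistSet n n, p A := by
    constructor
    · rintro ⟨w, hw⟩
      exact ⟨_, hmem w, hw⟩
    · rintro ⟨A, hA, hp⟩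
      obtain ⟨w, -, rfl⟩ := hbij.surjOn hA
      exact ⟨w, hp⟩
  obtain ⟨e₁⟩ := nonempty_equiv_graph
    (P := fun z w => (braidProd n l z * braidProd n (halfTwistWord n) w).BlockTriangular id)
    (Q := fun z w => ((braidProd n (halfTwistWord n) w)⁻¹ * braidProd n l z).BlockTriangular id)
    (fun z w w' h h' => hbij.injOn trivial trivial <|
      eq_of_blockTriangular_inv_mul (hmem w) (hmem w') (hunit w) <| by
        have h1 := (h.nonsing_inv ((hMunit z).mul (hunit w))).mul h'
        rwa [Matrix.mul_inv_rev, mul_assoc, Matrix.nonsing_inv_mul_cancel_left _ _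
          ((Matrix.isUnit_iff_isUnit_det _).1 (hMunit z))] at h1)
    (fun z w w' h h' => hbij.injOn trivial trivial <|
      eq_of_blockTriangular_inv_mul (hmem w) (hmem w') (hunit w) <| by
        have h1 := h.mul (h'.nonsing_inv
          ((Matrix.isUnit_nonsing_inv_iff.2 (hunit w')).mul (hMunit z)))
        rwa [Matrix.mul_inv_rev, mul_assoc, Matrix.mul_nonsing_inv_cancel_left _ _
          ((Matrix.isUnit_iff_isUnit_det _).1 (hMunit z)), Matrix.nonsing_inv_nonsing_inv _
          ((Matrix.isUnit_iff_isUnit_det _).1 (hunit w'))] at h1)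
    (fun z => by
      rw [hex fun A => (braidProd n l z * A).BlockTriangular id,
        hex fun A => (A⁻¹ * braidProd n l z).BlockTriangular id]
      exact exists_mem_halfTwistSet_iff hS (hMunit z))
  have hw0 : (w0mat n)⁻¹ = w0mat n := Matrix.inv_eq_right_inv (w0mat_mul_self n)
  choose e V hV hV' hUV using fun w => exists_equiv_mul_braidProd n l hl
    (braidProd n (halfTwistWord n) w * w0mat n)⁻¹
    ((blockTriangular_mul_w0mat (hmem w)).nonsing_inv ((hunit w).mul (isUnit_w0mat n)))
    (Matrix.isUnit_nonsing_inv_iff.2 ((hunit w).mul (isUnit_w0mat n)))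
  have hslide (z w) : ((braidProd n (halfTwistWord n) w)⁻¹ * braidProd n l z).BlockTriangular id ↔
      (w0mat n * braidProd n l (e w z)).BlockTriangular id := by
    rw [← blockTriangular_mul_iff_of_isUnit (w0mat n * _) (hV w z) (hV' w z), mul_assoc, ← hUV,
      Matrix.mul_inv_rev, hw0, ← mul_assoc, ← mul_assoc, w0mat_mul_self, one_mul]
  let e₂ : (Fin l.length → ℂ) × (Fin (halfTwistWord n).length → ℂ) ≃
      (Fin l.length → ℂ) × (Fin (halfTwistWord n).length → ℂ) :=
    (Equiv.prodComm _ _).trans ((Equiv.prodShear (Equiv.refl _) e).trans (Equiv.prodComm _ _))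
  have e₃ : {z // (braidProd n (l ++ halfTwistWord n) z).BlockTriangular id} ≃
      {p : (Fin l.length → ℂ) × (Fin (halfTwistWord n).length → ℂ) //
        (braidProd n l p.1 * braidProd n (halfTwistWord n) p.2).BlockTriangular id} :=
    e₀.subtypeEquiv fun z => by rw [he₀]
  have e₄ : {p : (Fin l.length → ℂ) × (Fin (halfTwistWord n).length → ℂ) //
        ((braidProd n (halfTwistWord n) p.2)⁻¹ * braidProd n l p.1).BlockTriangular id} ≃
      {p : (Fin l.length → ℂ) × (Fin (halfTwistWord n).length → ℂ) //
        (w0mat n * braidProd n l p.1).BlockTriangular id} :=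
    e₂.subtypeEquiv fun p => hslide p.1 p.2
  have e₅ : {p : (Fin l.length → ℂ) × (Fin (halfTwistWord n).length → ℂ) //
        (w0mat n * braidProd n l p.1).BlockTriangular id} ≃
      {z // (w0mat n * braidProd n l z).BlockTriangular id} ×
        (Fin (halfTwistWord n).length → ℂ) :=
    Equiv.prodSubtypeFstEquivSubtypeProd
      (p := fun z => (w0mat n * braidProd n l z).BlockTriangular id)
  exact ⟨((e₃.trans e₁).trans (e₄.trans e₅)).trans
    ((Equiv.refl _).prodCongr ((finCongr hlen).arrowCongr (Equiv.refl ℂ)))⟩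
end
end
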